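/- A finitely generated group that is linear over some field and satisfies a probabilistic identity satisfies an identity; that is, there is a nontrivial word w ∈ F_n with w(g_1,…,g_n) = 1 for all g_1,…,g_n ∈ Γ. -/

import Mathlib

universe u v

/-- A group is linear (over some field) if it admits a faithful homomorphism into
`GL_k(F)` for some `k` and some field `F`. -/
def IsLinearGroup (Γ : Type u) [Group Γ] : Prop :=
  ∃ (F : Type v) (_ : Field F) (k : ℕ)
    (ρ : Γ →* Matrix.GeneralLinearGroup (Fin k) F), Function.Injective ρ

/-- The probability that a word `w ∈ F_n` evaluates to `1` at an independent uniformly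
random `n`-tuple of elements of `Q`. -/
noncomputable def wordProb (Q : Type*) [Group Q] {n : ℕ} (w : FreeGroup (Fin n)) : ℝ :=
  (Nat.card {h : Fin n → Q // FreeGroup.lift h w = 1} : ℝ) / (Nat.card Q : ℝ) ^ n

/-- A nontrivial word `w ∈ F_n` is a probabilistic identity of `Γ` if there is `ε > 0`
such that in every finite quotient of `Γ` the probability that `w = 1` is at least `ε`. -/
def IsProbabilisticIdentity (Γ : Type u) [Group Γ] {n : ℕ} (w : FreeGroup (Fin n)) : Prop :=
  w ≠ 1 ∧ ∃ ε : ℝ, 0 < ε ∧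
    ∀ (N : Subgroup Γ) (_ : N.Normal), N.FiniteIndex → ε ≤ wordProb (Γ ⧸ N) w



lemma exists_word_derived (m : ℕ) : ∃ (n : ℕ) (w : FreeGroup (Fin n)), w ≠ 1 ∧
    w ∈ derivedSeries (FreeGroup (Fin n)) m := by
  let G := Equiv.Perm (Fin 5)
  let n := Fintype.card G
  let e : Fin n ≃ G := (Fintype.equivFin G).symm
  refine ⟨n, ?_⟩
  by_contra! h
  have hs : Group.IsSolvable (FreeGroup (Fin n)) := ⟨m, by
    rw [eq_bot_iff]
    intro w hw
    by_contra hne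
    exact h w (by simpa using hne) hw⟩
  have hsurj : Function.Surjective (FreeGroup.lift (e : Fin n → G)) := by
    intro g
    exact ⟨FreeGroup.of (e.symm g), by simp⟩
  have := Group.isSolvable_of_surjective hsurj
  exact Equiv.Perm.not_isSolvable_fin_5 this

lemma lift_mk_pow {α G : Type*} [Group G] (f : α → G) (m : ℕ) (L : List (α × Bool)) :
    FreeGroup.lift (fun i => f i ^ m) (FreeGroup.mk L) =
      FreeGroup.lift f (FreeGroup.mk (L.flatMap (List.replicate m))) := by
  induction L with
  | nil => simp
  | cons a L ih =>
    simp only [FreeGroup.lift_mk, List.map_cons, List.prod_cons, List.flatMap_cons,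
      List.map_append, List.prod_append] at ih ⊢
    rw [ih]
    congr 1
    rcases a with ⟨i, b⟩
    cases b <;> simp

lemma pow_word_ne_one {n : ℕ} (w : FreeGroup (Fin n)) (hw : w ≠ 1) {m : ℕ} (hm : m ≠ 0) :
    FreeGroup.lift (fun i => FreeGroup.of i ^ m) w ≠ 1 := by
  classical
  intro h
  apply hw
  have hr := FreeGroup.isReduced_toWord (x := w)
  rw [← FreeGroup.mk_toWord (x := w), lift_mk_pow] at h
  have hid : (FreeGroup.lift (FreeGroup.of : Fin n → FreeGroup (Fin n))) = MonoidHom.id _ := by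
    ext; simp
  rw [hid, MonoidHom.id_apply] at h
  have h2 : FreeGroup.IsReduced (w.toWord.flatMap (List.replicate m)) := by
    unfold FreeGroup.IsReduced at hr ⊢
    rw [List.flatMap, List.isChain_flatten (by simp [hm])]
    constructor
    · simp only [List.mem_map, forall_exists_index, and_imp, forall_apply_eq_imp_iff₂]
      intro a _
      exact List.isChain_replicate_of_rel _ (fun _ => rfl)
    · rw [List.isChain_map]
      refine hr.imp ?_
      intro a b hab x hx y hy
      have hx' : x = a := by
        have := List.mem_of_getLast? hx
        exact List.eq_of_mem_replicate this
      have hy' : y = b := by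
        have := List.mem_of_head? hy
        exact List.eq_of_mem_replicate this
      rw [hx', hy']; exact hab
  have h3 := congrArg FreeGroup.toWord h
  rw [FreeGroup.toWord_mk, h2.reduce_eq, FreeGroup.toWord_one] at h3
  rw [← FreeGroup.toWord_eq_nil_iff]
  rcases hw2 : w.toWord with _ | ⟨a, l⟩
  · rfl
  · rw [hw2] at h3
    simp [hm] at h3

lemma identity_of_virtually_solvable {Γ : Type*} [Group Γ] (N : Subgroup Γ) [N.Normal]
    [N.FiniteIndex] [Group.IsSolvable N] :
    ∃ (n : ℕ) (w : FreeGroup (Fin n)), w ≠ 1 ∧ ∀ g : Fin n → Γ, FreeGroup.lift g w = 1 := by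
  obtain ⟨k, hk⟩ := Group.IsSolvable.solvable (G := N)
  obtain ⟨n, w, hw, hwd⟩ := exists_word_derived k
  refine ⟨n, FreeGroup.lift (fun i => FreeGroup.of i ^ N.index) w,
    pow_word_ne_one w hw Subgroup.FiniteIndex.index_ne_zero, fun g => ?_⟩
  let u : Fin n → N := fun i => ⟨g i ^ N.index, N.pow_index_mem (g i)⟩
  have h1 : FreeGroup.lift u w = 1 := by
    have : FreeGroup.lift u w ∈ derivedSeries N k := by
      apply map_derivedSeries_le_derivedSeries (FreeGroup.lift u) k
      exact Subgroup.mem_map_of_mem _ hwd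
    rw [hk] at this
    simpa using this
  have h2 : (FreeGroup.lift g).comp (FreeGroup.lift (fun i => FreeGroup.of i ^ N.index)) =
      N.subtype.comp (FreeGroup.lift u) := by
    ext i; simp [u]
  have h3 := DFunLike.congr_fun h2 w
  simp only [MonoidHom.comp_apply] at h3
  rw [h3, h1, map_one]


section coordAlg
variable {H A ι κ : Type*} [Group H] [CommRing A] [Fintype κ] [DecidableEq κ]

/-- The coordinate generators: matrix entries of `g` and of `g⁻¹`. -/
def coordGen (σ : ι → H →* Matrix κ κ A) (p : ι × κ × κ × Bool) : H → A :=
  fun g => σ p.1 (if p.2.2.2 then g else g⁻¹) p.2.1 p.2.2.1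

/-- The algebra of polynomial functions on `H`. -/
def coordAlg (σ : ι → H →* Matrix κ κ A) : Subalgebra A (H → A) :=
  Algebra.adjoin A (Set.range (coordGen σ))

lemma coordAlg_entry (σ : ι → H →* Matrix κ κ A) (i : ι) (a b : κ) :
    (fun g => σ i g a b) ∈ coordAlg σ :=
  Algebra.subset_adjoin ⟨(i, a, b, true), rfl⟩

lemma coordAlg_entry_inv (σ : ι → H →* Matrix κ κ A) (i : ι) (a b : κ) :
    (fun g => σ i g⁻¹ a b) ∈ coordAlg σ :=
  Algebra.subset_adjoin ⟨(i, a, b, false), rfl⟩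

instance coordAlg_noeth [Finite ι] [IsNoetherianRing A] (σ : ι → H →* Matrix κ κ A) :
    IsNoetherianRing (coordAlg σ) := by
  have : Algebra.FiniteType A (coordAlg σ) :=
    Algebra.FiniteType.adjoin_of_finite (Set.finite_range _)
  exact Algebra.FiniteType.isNoetherianRing A _

lemma coordAlg_comp (σ : ι → H →* Matrix κ κ A) (φ : H → H)
    (h1 : ∀ i a b, (fun g => σ i (φ g) a b) ∈ coordAlg σ)
    (h2 : ∀ i a b, (fun g => σ i (φ g)⁻¹ a b) ∈ coordAlg σ)
    (f : H → A) (hf : f ∈ coordAlg σ) : (fun g => f (φ g)) ∈ coordAlg σ := by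
  induction hf using Algebra.adjoin_induction with
  | mem x hx =>
    obtain ⟨⟨i, a, b, c⟩, rfl⟩ := hx
    cases c
    · exact h2 i a b
    · exact h1 i a b
  | algebraMap r => exact (coordAlg σ).algebraMap_mem r
  | add x y _ _ hx hy => exact (coordAlg σ).add_mem hx hy
  | mul x y _ _ hx hy => exact (coordAlg σ).mul_mem hx hy

lemma coordAlg_const (σ : ι → H →* Matrix κ κ A) (c : A) : (fun _ : H => c) ∈ coordAlg σ :=
  (coordAlg σ).algebraMap_mem c

lemma coordAlg_sum (σ : ι → H →* Matrix κ κ A) {s : Type*} [Fintype s] (f : s → H → A)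
    (hf : ∀ i, f i ∈ coordAlg σ) : (fun g => ∑ i, f i g) ∈ coordAlg σ := by
  have := (coordAlg σ).sum_mem (t := Finset.univ) (fun i _ => hf i)
  convert this using 1
  ext g; simp

lemma coordAlg_right (σ : ι → H →* Matrix κ κ A) (h : H) (f : H → A) (hf : f ∈ coordAlg σ) :
    (fun g => f (g * h)) ∈ coordAlg σ := by
  refine coordAlg_comp σ (fun g => g * h) ?_ ?_ f hf
  · intro i a b
    simp only [map_mul, Matrix.mul_apply]
    exact coordAlg_sum σ _ fun c => (coordAlg σ).mul_mem (coordAlg_entry σ i a c)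
      (coordAlg_const σ (σ i h c b))
  · intro i a b
    simp only [mul_inv_rev, map_mul, Matrix.mul_apply]
    exact coordAlg_sum σ _ fun c => (coordAlg σ).mul_mem (coordAlg_const σ (σ i h⁻¹ a c))
      (coordAlg_entry_inv σ i c b)

lemma coordAlg_left (σ : ι → H →* Matrix κ κ A) (h : H) (f : H → A) (hf : f ∈ coordAlg σ) :
    (fun g => f (h * g)) ∈ coordAlg σ := by
  refine coordAlg_comp σ (fun g => h * g) ?_ ?_ f hf
  · intro i a b
    simp only [map_mul, Matrix.mul_apply]
    exact coordAlg_sum σ _ fun c => (coordAlg σ).mul_mem (coordAlg_const σ (σ i h a c))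
      (coordAlg_entry σ i c b)
  · intro i a b
    simp only [mul_inv_rev, map_mul, Matrix.mul_apply]
    exact coordAlg_sum σ _ fun c => (coordAlg σ).mul_mem (coordAlg_entry_inv σ i a c)
      (coordAlg_const σ (σ i h⁻¹ c b))

lemma coordAlg_inv (σ : ι → H →* Matrix κ κ A) (f : H → A) (hf : f ∈ coordAlg σ) :
    (fun g => f g⁻¹) ∈ coordAlg σ := by
  refine coordAlg_comp σ (fun g => g⁻¹) ?_ ?_ f hf
  · intro i a b
    exact coordAlg_entry_inv σ i a b
  · intro i a b
    simp only [inv_inv]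
    exact coordAlg_entry σ i a b

/-- Right translation action. -/
instance coordAction (σ : ι → H →* Matrix κ κ A) : MulSemiringAction H (coordAlg σ) where
  smul h f := ⟨fun g => f.1 (g * h), coordAlg_right σ h f.1 f.2⟩
  one_smul f := by ext g; change f.1 (g * 1) = f.1 g; rw [mul_one]
  mul_smul h h' f := by
    ext g; change f.1 (g * (h * h')) = f.1 (g * h * h'); rw [mul_assoc]
  smul_zero h := rfl
  smul_add h f f' := rfl
  smul_one h := rfl
  smul_mul h f f' := rfl

/-- Evaluation. -/
def coordEv (σ : ι → H →* Matrix κ κ A) (g : H) : coordAlg σ →+* A :=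
  (Pi.evalRingHom (fun _ : H => A) g).comp (coordAlg σ).val.toRingHom

lemma coordEv_apply (σ : ι → H →* Matrix κ κ A) (g : H) (f : coordAlg σ) :
    coordEv σ g f = f.1 g := rfl

lemma coordEv_smul (σ : ι → H →* Matrix κ κ A) (g h : H) (f : coordAlg σ) :
    coordEv σ g (h • f) = coordEv σ (g * h) f := rfl
end coordAlg


open Pointwise in
lemma almost_disjoint_bound {ι X : Type*} [Finite X] (t : Finset ι) (Y : ι → Set X)
    (a b : ℝ) (ha : ∀ i ∈ t, a ≤ (Y i).ncard)
    (hb : ∀ i ∈ t, ∀ j ∈ t, i ≠ j → ((Y i ∩ Y j).ncard : ℝ) ≤ b) (hb0 : 0 ≤ b) :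
    (t.card : ℝ) * (a - t.card * b) ≤ Nat.card X := by
  classical
  have := Fintype.ofFinite X
  let Yf : ι → Finset X := fun i => (Y i).toFinset
  let Z : ι → Finset X := fun i => Yf i \ (t.erase i).biUnion (fun j => Yf i ∩ Yf j)
  have hdis : (t : Set ι).PairwiseDisjoint Z := by
    intro i hi j hj hij
    rw [Function.onFun, Finset.disjoint_left]
    intro x hx hx'
    simp only [Z, Finset.mem_sdiff, Finset.mem_biUnion, not_exists, Finset.mem_erase, not_and,
      Finset.mem_inter] at hx hx'
    exact hx.2 j ⟨fun h => hij h.symm, hj⟩ hx.1 hx'.1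
  have hZ : ∀ i ∈ t, a - t.card * b ≤ ((Z i).card : ℝ) := by
    intro i hi
    have h1 : (Yf i).card ≤ (Z i).card + ((t.erase i).biUnion (fun j => Yf i ∩ Yf j)).card := by
      have := Finset.card_le_card_sdiff_add_card (s := Yf i)
        (t := (t.erase i).biUnion (fun j => Yf i ∩ Yf j))
      simpa [Z] using this
    have h2 : (((t.erase i).biUnion (fun j => Yf i ∩ Yf j)).card : ℝ) ≤ t.card * b := by
      calc (((t.erase i).biUnion (fun j => Yf i ∩ Yf j)).card : ℝ)
          ≤ ((∑ j ∈ t.erase i, (Yf i ∩ Yf j).card : ℕ) : ℝ) := by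
            exact_mod_cast Finset.card_biUnion_le
        _ = ∑ j ∈ t.erase i, ((Yf i ∩ Yf j).card : ℝ) := by push_cast; rfl
        _ ≤ ∑ j ∈ t.erase i, b := by
            apply Finset.sum_le_sum
            intro j hj
            rw [Finset.mem_erase] at hj
            have := hb i hi j hj.2 (fun h => hj.1 h.symm)
            rw [Set.ncard_eq_toFinset_card'] at this
            simpa [Yf] using this
        _ = (t.erase i).card * b := by simp
        _ ≤ t.card * b := by
            gcongr
            exact Finset.erase_subset _ _
    have h3 := ha i hi
    rw [Set.ncard_eq_toFinset_card'] at h3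
    have h1' : ((Yf i).card : ℝ) ≤ (Z i).card +
      ((t.erase i).biUnion (fun j => Yf i ∩ Yf j)).card := by exact_mod_cast h1
    have h3' : a ≤ ((Yf i).card : ℝ) := h3
    linarith
  calc (t.card : ℝ) * (a - t.card * b) = ∑ i ∈ t, (a - t.card * b) := by
        rw [Finset.sum_const, nsmul_eq_mul]
    _ ≤ ∑ i ∈ t, ((Z i).card : ℝ) := Finset.sum_le_sum hZ
    _ = ((t.biUnion Z).card : ℝ) := by rw [Finset.card_biUnion hdis]; push_cast; rfl
    _ ≤ Nat.card X := by
      rw [Nat.card_eq_fintype_card]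
      exact_mod_cast Finset.card_le_univ _

section density
variable {H A R : Type*} [Group H] [CommRing A] [CommRing R] [MulSemiringAction H R]

/-- Zero set of an ideal at level `j`. -/
def levelSet {X : Type*} [Group X] (π : H →* X) (ev : H → R →+* A) (𝔞 : Ideal A) (I : Ideal R) :
    Set X :=
  {c | ∀ g, π g = c → ∀ f ∈ I, ev g f ∈ 𝔞}

open Pointwise in
lemma levelSet_smul {X : Type*} [Group X] (π : H →* X) (ev : H → R →+* A)
    (hev : ∀ g h f, ev g (h • f) = ev (g * h) f) (𝔞 : Ideal A) (I : Ideal R) (h : H) :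
    levelSet π ev 𝔞 (h • I) = (Equiv.mulRight (π h)) ⁻¹' levelSet π ev 𝔞 I := by
  ext c
  simp only [levelSet, Set.mem_ofPred_eq, Set.mem_preimage, Equiv.coe_mulRight]
  constructor
  · intro hc g hg f hf
    have := hc (g * h⁻¹) (by rw [map_mul, hg, map_inv]; group) (h • f)
      (Ideal.smul_mem_pointwise_smul _ _ _ hf)
    rwa [hev, inv_mul_cancel_right] at this
  · intro hc g hg f hf
    rw [Ideal.mem_pointwise_smul_iff_inv_smul_mem] at hf
    have := hc (g * h) (by rw [map_mul, hg]) _ hf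
    rwa [hev, mul_inv_cancel_right] at this

open Pointwise in
lemma ncard_levelSet_smul {X : Type*} [Group X] (π : H →* X) (ev : H → R →+* A)
    (hev : ∀ g h f, ev g (h • f) = ev (g * h) f) (𝔞 : Ideal A) (I : Ideal R) (h : H) :
    (levelSet π ev 𝔞 (h • I)).ncard = (levelSet π ev 𝔞 I).ncard := by
  rw [levelSet_smul π ev hev, Set.ncard_preimage_of_injective_subset_range]
  · exact (Equiv.mulRight (π h)).injective
  · intro x _; exact (Equiv.mulRight (π h)).surjective x

open Pointwise in
lemma coset_zero_of_density [IsNoetherianRing R] (ev : H → R →+* A)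
    (hev : ∀ g h f, ev g (h • f) = ev (g * h) f)
    (𝔞 : ℕ → Ideal A) (hanti : Antitone 𝔞) (h0 : ∀ a, (∀ j, a ∈ 𝔞 j) → a = 0)
    (X : ℕ → Type*) [∀ j, Group (X j)] [∀ j, Finite (X j)] (π : ∀ j, H →* X j)
    (hsurj : ∀ j, Function.Surjective (π j))
    (I₀ : Ideal R) (ε : ℝ) (hε : 0 < ε)
    (hd : ∀ j, ε * Nat.card (X j) ≤ (levelSet (π j) ev (𝔞 j) I₀).ncard) :
    ∃ S : Subgroup H, S.FiniteIndex ∧ ∃ y, ∀ s ∈ S, ∀ f ∈ I₀, ev (y * s) f = 0 := by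
  classical
  let U : Ultrafilter ℕ := Filter.hyperfilter ℕ
  let P : Ideal R → Prop := fun I => ∃ δ : ℝ, 0 < δ ∧
    ∀ᶠ j in (U : Filter ℕ), δ * Nat.card (X j) ≤ (levelSet (π j) ev (𝔞 j) I).ncard
  have hP0 : P I₀ := ⟨ε, hε, Filter.Eventually.of_forall hd⟩
  have hPsmul : ∀ (h : H) I, P I → P (h • I) := by
    rintro h I ⟨δ, hδ, hI⟩
    refine ⟨δ, hδ, hI.mono fun j hj => ?_⟩
    rwa [ncard_levelSet_smul (π j) ev hev]
  obtain ⟨I, hI, hmax⟩ := set_has_maximal_iff_noetherian.mpr ‹IsNoetherian R R›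
    {J : Ideal R | I₀ ≤ J ∧ P J} ⟨I₀, le_rfl, hP0⟩
  obtain ⟨hI0, hPI⟩ := hI
  have hmax' : ∀ J, I ≤ J → P J → J = I := by
    intro J hJ hPJ
    by_contra hne
    exact hmax J ⟨hI0.trans hJ, hPJ⟩ (lt_of_le_of_ne hJ (fun h => hne h.symm))
  have hmax2 : ∀ (h : H) J, h • I ≤ J → P J → J = h • I := by
    intro h J hJ hPJ
    have : h⁻¹ • J = I := by
      apply hmax' _ _ (hPsmul _ _ hPJ)
      rw [← Ideal.pointwise_smul_le_pointwise_smul_iff (a := h)] 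
      simpa using hJ
    rw [← this]; simp
  obtain ⟨δ, hδ, hPδ⟩ := hPI
  -- the orbit is finite
  have hfin : (MulAction.orbit H I).Finite := by
    by_contra hinf
    obtain ⟨M, hM⟩ := exists_nat_gt (2 / δ)
    obtain ⟨t, htsub, htc⟩ := Set.Infinite.exists_subset_card_eq hinf M
    have hMpos : (0 : ℝ) < M := lt_trans (by positivity) hM
    have h1 : ∀ I1 ∈ t, ∀ I2 ∈ t, I1 ≠ I2 → ∀ᶠ j in (U : Filter ℕ),
        ((levelSet (π j) ev (𝔞 j) I1 ∩ levelSet (π j) ev (𝔞 j) I2).ncard : ℝ) ≤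
          δ / (2 * M) * Nat.card (X j) := by
      intro I1 h1 I2 h2 hne
      have hnP : ¬ P (I1 ⊔ I2) := by
        intro hP
        obtain ⟨g1, hg1⟩ := htsub h1
        obtain ⟨g2, hg2⟩ := htsub h2
        simp only at hg1 hg2
        apply hne
        have e1 := hmax2 g1 (I1 ⊔ I2) (by rw [hg1]; exact le_sup_left) hP
        have e2 := hmax2 g2 (I1 ⊔ I2) (by rw [hg2]; exact le_sup_right) hP
        rw [hg1] at e1
        rw [hg2] at e2
        rw [← e1, e2]
      have hnP' : ∀ᶠ j in (U : Filter ℕ), ¬ (δ / (2 * M) * Nat.card (X j) ≤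
          (levelSet (π j) ev (𝔞 j) (I1 ⊔ I2)).ncard) := by
        rw [Ultrafilter.eventually_not]
        intro h
        exact hnP ⟨_, by positivity, h⟩
      refine hnP'.mono fun j hj => ?_
      push Not at hj
      refine le_trans ?_ hj.le
      have : levelSet (π j) ev (𝔞 j) I1 ∩ levelSet (π j) ev (𝔞 j) I2 ⊆
          levelSet (π j) ev (𝔞 j) (I1 ⊔ I2) := by
        rintro c ⟨hc1, hc2⟩ g hg f hf
        obtain ⟨f1, hf1, f2, hf2, rfl⟩ := Submodule.mem_sup.mp hf
        rw [map_add]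
        exact Ideal.add_mem _ (hc1 g hg f1 hf1) (hc2 g hg f2 hf2)
      exact_mod_cast Set.ncard_le_ncard this (Set.toFinite _)
    have h2 : ∀ᶠ j in (U : Filter ℕ), ∀ I1 ∈ t, ∀ I2 ∈ t, I1 ≠ I2 →
        ((levelSet (π j) ev (𝔞 j) I1 ∩ levelSet (π j) ev (𝔞 j) I2).ncard : ℝ) ≤
          δ / (2 * M) * Nat.card (X j) := by
      rw [Filter.eventually_all_finset]
      intro I1 hI1
      rw [Filter.eventually_all_finset]
      intro I2 hI2
      rw [Filter.eventually_imp_distrib_left]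
      exact h1 I1 hI1 I2 hI2
    obtain ⟨j, hj1, hj2⟩ := (h2.and hPδ).exists
    have hc : (0 : ℝ) < Nat.card (X j) := by exact_mod_cast Nat.card_pos
    have := almost_disjoint_bound t (fun I => levelSet (π j) ev (𝔞 j) I) (δ * Nat.card (X j))
      (δ / (2 * M) * Nat.card (X j)) (by
        intro I1 hI1
        obtain ⟨g1, hg1⟩ := htsub hI1
        simp only at hg1
        rw [← hg1, ncard_levelSet_smul (π j) ev hev]
        exact hj2) hj1 (by positivity)
    rw [htc] at this
    have e : (M : ℝ) * (δ * Nat.card (X j) - M * (δ / (2 * M) * Nat.card (X j))) =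
        (M * δ / 2) * Nat.card (X j) := by
      field_simp; ring
    rw [e] at this
    have h3 : 1 < M * δ / 2 := by
      rw [div_lt_iff₀ hδ] at hM
      linarith
    nlinarith
  let S := MulAction.stabilizer H I
  have hSfin : S.FiniteIndex := by
    constructor
    rw [MulAction.index_stabilizer]
    exact ((Set.ncard_pos hfin).mpr ⟨I, MulAction.mem_orbit_self I⟩).ne'
  refine ⟨S, hSfin, ?_⟩
  have hpt : ∀ᶠ j in (U : Filter ℕ), ∃ c : H ⧸ S, ∃ g : H, (g : H ⧸ S) = c ∧
      π j g ∈ levelSet (π j) ev (𝔞 j) I := by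
    refine hPδ.mono fun j hj => ?_
    have hc : (0 : ℝ) < Nat.card (X j) := by exact_mod_cast Nat.card_pos
    have : 0 < (levelSet (π j) ev (𝔞 j) I).ncard := by
      have : (0 : ℝ) < (levelSet (π j) ev (𝔞 j) I).ncard := lt_of_lt_of_le (by positivity) hj
      exact_mod_cast this
    obtain ⟨c, hc⟩ := (Set.ncard_pos (Set.toFinite _)).mp this
    obtain ⟨g, rfl⟩ := hsurj j c
    exact ⟨g, g, rfl, hc⟩
  have : Finite (H ⧸ S) := Subgroup.finite_quotient_of_finiteIndex
  rw [Ultrafilter.eventually_exists_iff] at hpt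
  obtain ⟨c, hc⟩ := hpt
  obtain ⟨y, rfl⟩ := QuotientGroup.mk_surjective c
  refine ⟨y, fun s hs f hf => h0 _ fun j => ?_⟩
  have hfreq : ∃ᶠ i in Filter.atTop, ∃ g : H, (g : H ⧸ S) = (y : H ⧸ S) ∧
      π i g ∈ levelSet (π i) ev (𝔞 i) I := by
    have := hc.frequently
    refine this.filter_mono ?_
    rw [← Nat.cofinite_eq_atTop]
    exact Filter.hyperfilter_le_cofinite
  obtain ⟨i, hij, g, hg, hgI⟩ := Filter.frequently_atTop.mp hfreq j
  apply hanti hij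
  have hs2 : g⁻¹ * (y * s) ∈ S := by
    rw [← mul_assoc]
    exact S.mul_mem (QuotientGroup.eq.mp hg) hs
  have := hgI g rfl ((g⁻¹ * (y * s)) • f) (by
    have h1 : (g⁻¹ * (y * s)) • I = I := hs2
    have h2 := Ideal.smul_mem_pointwise_smul (g⁻¹ * (y * s)) f I (hI0 hf)
    rwa [h1] at h2)
  rwa [hev, mul_inv_cancel_left] at this
end density


open Pointwise in
lemma minimalPrimes_smul {H R : Type*} [Group H] [CommRing R] [MulSemiringAction H R]
    (h : H) (p : Ideal R) (hp : p ∈ minimalPrimes R) : h • p ∈ minimalPrimes R := by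
  have hsm : ∀ (h : H) (q : Ideal R), q.IsPrime → (h • q).IsPrime := by
    intro h q hq
    infer_instance
  refine ⟨⟨hsm h p hp.1.1, bot_le⟩, ?_⟩
  rintro q ⟨hq, -⟩ hle
  have h1 : h⁻¹ • q ≤ p := by
    rw [← Ideal.pointwise_smul_le_pointwise_smul_iff (a := h)]
    simpa using hle
  have h2 := hp.2 ⟨hsm h⁻¹ q hq, bot_le⟩ h1
  rw [← Ideal.pointwise_smul_le_pointwise_smul_iff (a := h)] at h2
  simpa using h2

open Pointwise in
lemma exists_connected_subgroup {H R K : Type*} [Group H] [CommRing R] [IsNoetherianRing R]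
    [MulSemiringAction H R] [CommRing K] [IsDomain K] (ev : H → R →+* K)
    (hev : ∀ g h f, ev g (h • f) = ev (g * h) f) (hinj : ∀ f, (∀ g, ev g f = 0) → f = 0) :
    ∃ S : Subgroup H, S.FiniteIndex ∧ ∀ N : Subgroup H, N.FiniteIndex → N ≤ S → ∀ f f' : R,
      (∀ v ∈ N, ev v f * ev v f' = 0) → (∀ v ∈ N, ev v f = 0) ∨ (∀ v ∈ N, ev v f' = 0) := by
  have hk : (RingHom.ker (ev 1)).IsPrime := RingHom.ker_isPrime _
  obtain ⟨p, hp, hple⟩ := Ideal.exists_minimalPrimes_le (bot_le : ⊥ ≤ RingHom.ker (ev 1))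
  change p ∈ minimalPrimes R at hp
  have hfin : (MulAction.orbit H p).Finite := by
    refine (minimalPrimes.finite_of_isNoetherianRing R).subset ?_
    rintro _ ⟨h, rfl⟩
    exact minimalPrimes_smul h p hp
  have hpp : p.IsPrime := hp.1.1
  refine ⟨MulAction.stabilizer H p, ⟨?_⟩, ?_⟩
  · rw [MulAction.index_stabilizer]
    exact ((Set.ncard_pos hfin).mpr ⟨p, MulAction.mem_orbit_self p⟩).ne'
  intro N hN hNS
  let I : Ideal R := 
    { carrier := {f | ∀ v ∈ N, ev v f = 0}
      add_mem' := by
        intro a b ha hb v hv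
        rw [map_add, ha v hv, hb v hv, add_zero]
      zero_mem' := by intro v _; exact map_zero _
      smul_mem' := by
        intro c a ha v hv
        rw [smul_eq_mul, map_mul, ha v hv, mul_zero] }
  have hI : ∀ f, f ∈ I ↔ ∀ v ∈ N, ev v f = 0 := fun f => Iff.rfl
  have hpI : p ≤ I := by
    intro f hf v hv
    have h1 : v • p = p := hNS hv
    have h2 := Ideal.smul_mem_pointwise_smul v f p hf
    rw [h1] at h2
    have := hple h2
    rw [RingHom.mem_ker, hev, one_mul] at this
    exact this
  have hIp : I = p := by
    have : Finite (H ⧸ N) := Subgroup.finite_quotient_of_finiteIndex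
    have := Fintype.ofFinite (H ⧸ N)
    have hprod : ∏ c : H ⧸ N, (Quotient.out c : H) • I ≤ p := by
      intro f hf
      have : f = 0 := by
        apply hinj
        intro g
        have h1 := (Ideal.prod_le_inf.trans (Finset.inf_le (Finset.mem_univ ((g⁻¹ : H) : H ⧸ N)))) hf
        rw [Ideal.mem_pointwise_smul_iff_inv_smul_mem, hI] at h1
        set t := Quotient.out ((g⁻¹ : H) : H ⧸ N) with ht
        have h2 : (t : H ⧸ N) = ((g⁻¹ : H) : H ⧸ N) := Quotient.out_eq _
        have h3 : g * t ∈ N := by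
          have := QuotientGroup.eq.mp h2.symm
          simpa using this
        have := h1 _ h3
        rwa [hev, mul_inv_cancel_right] at this
      rw [this]; exact p.zero_mem
    obtain ⟨c, -, hc⟩ := (Ideal.IsPrime.prod_le hpp).mp hprod
    set t := (Quotient.out c : H)
    have h1 : I ≤ t⁻¹ • p := by
      rw [← Ideal.pointwise_smul_le_pointwise_smul_iff (a := t)]
      simpa using hc
    have h2 := (minimalPrimes_smul t⁻¹ p hp).2 ⟨hpp, bot_le⟩ (hpI.trans h1)
    exact le_antisymm (h1.trans h2) hpI
  intro f f' hff
  have : f * f' ∈ I := by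
    intro v hv
    rw [map_mul]; exact hff v hv
  rw [hIp] at this
  rcases hpp.mem_or_mem this with h | h
  · left; rw [← hIp] at h; exact h
  · right; rw [← hIp] at h; exact h


lemma isJacobsonRing_int : IsJacobsonRing ℤ := by
  rw [isJacobsonRing_iff_prime_eq]
  intro P hP
  by_cases h : P = ⊥
  · subst h
    rw [eq_bot_iff]
    intro x hx
    rw [Ideal.mem_jacobson_bot] at hx
    have h1 := Int.isUnit_iff.mp (hx x)
    have : x * x = 0 := by
      rcases h1 with h1 | h1
      · linarith
      · nlinarith [mul_self_nonneg x]
    simpa using this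
  · have : P.IsMaximal := hP.isMaximal h
    exact Ideal.jacobson_eq_self_of_isMaximal

lemma finite_residue {A : Type*} [CommRing A] [Algebra.FiniteType ℤ A] (m : Ideal A)
    [hm : m.IsMaximal] : Finite (A ⧸ m) := by
  let _ : Field (A ⧸ m) := Ideal.Quotient.field m
  have : Algebra.FiniteType ℤ (A ⧸ m) := Algebra.FiniteType.of_surjective (Ideal.Quotient.mkₐ ℤ m)
    (Ideal.Quotient.mkₐ_surjective ℤ m)
  have := isJacobsonRing_int
  have hfin : Module.Finite ℤ (A ⧸ m) := finite_of_finite_type_of_isJacobsonRing ℤ (A ⧸ m)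
  obtain ⟨p, hp⟩ := CharP.exists (A ⧸ m)
  rcases CharP.char_is_prime_or_zero (A ⧸ m) p with hpp | rfl
  · have : AddGroup.FG (A ⧸ m) := AddGroup.fg_iff_addMonoid_fg.mpr
      (Module.Finite.iff_addGroup_fg.mp hfin |> AddGroup.fg_iff_addMonoid_fg.mp)
    apply AddCommGroup.finite_of_fg_isAddTorsion
    intro x
    rw [isOfFinAddOrder_iff_nsmul_eq_zero]
    exact ⟨p, hpp.pos, by simp⟩
  · exfalso
    have : CharZero (A ⧸ m) := CharP.charP_to_charZero _
    have hinj : Function.Injective (algebraMap ℤ (A ⧸ m)) := RingHom.injective_int _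
    have := isField_of_isIntegral_of_isField hinj (Field.toIsField (A ⧸ m))
    exact Int.not_isField this

lemma exists_integral_model {Γ F : Type*} [Group Γ] [Group.FG Γ] [Field F] (k : ℕ)
    (ρ : Γ →* Matrix.GeneralLinearGroup (Fin k) F) (hρ : Function.Injective ρ) :
    ∃ (A : Subalgebra ℤ F) (σ : Γ →* Matrix (Fin k) (Fin k) A), Algebra.FiniteType ℤ A ∧
      Function.Injective σ := by
  obtain ⟨S, hS⟩ := Group.FG.out (G := Γ)
  let E : Set F := Set.range (fun p : {x // x ∈ S} × Fin k × Fin k × Bool =>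
    ρ (if p.2.2.2 then (p.1 : Γ) else (p.1 : Γ)⁻¹) p.2.1 p.2.2.1)
  let A := Algebra.adjoin ℤ E
  have hmem : ∀ g : Γ, ∀ a b, (ρ g : Matrix (Fin k) (Fin k) F) a b ∈ A := by
    intro g
    have hg : g ∈ Subgroup.closure (S : Set Γ) := by rw [hS]; trivial
    have hboth : (∀ a b, (ρ g : Matrix (Fin k) (Fin k) F) a b ∈ A) ∧
        (∀ a b, (ρ g⁻¹ : Matrix (Fin k) (Fin k) F) a b ∈ A) := by
      induction hg using Subgroup.closure_induction with
      | mem x hx =>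
        exact ⟨fun a b => Algebra.subset_adjoin ⟨(⟨x, hx⟩, a, b, true), rfl⟩,
          fun a b => Algebra.subset_adjoin ⟨(⟨x, hx⟩, a, b, false), rfl⟩⟩
      | one =>
        have : ∀ a b, (1 : Matrix (Fin k) (Fin k) F) a b ∈ A := by
          intro a b
          rw [Matrix.one_apply]
          split_ifs
          · exact A.one_mem
          · exact A.zero_mem
        simpa using this
      | mul x y _ _ hx hy =>
        constructor
        · intro a b
          rw [map_mul, Units.val_mul, Matrix.mul_apply]
          exact A.sum_mem fun c _ => A.mul_mem (hx.1 a c) (hy.1 c b)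
        · intro a b
          rw [mul_inv_rev, map_mul, Units.val_mul, Matrix.mul_apply]
          exact A.sum_mem fun c _ => A.mul_mem (hy.2 a c) (hx.2 c b)
      | inv x _ hx => rw [inv_inv]; exact ⟨hx.2, hx.1⟩
    exact hboth.1
  let σ : Γ →* Matrix (Fin k) (Fin k) A :=
    { toFun := fun g => Matrix.of fun a b => ⟨(ρ g : Matrix (Fin k) (Fin k) F) a b, hmem g a b⟩
      map_one' := by
        ext a b
        simp only [map_one, Units.val_one, Matrix.of_apply, Matrix.one_apply]
        split_ifs <;> rfl
      map_mul' := by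
        intro x y
        ext a b
        simp [Matrix.mul_apply] }
  refine ⟨A, σ, Algebra.FiniteType.adjoin_of_finite (Set.finite_range _), ?_⟩
  intro x y hxy
  apply hρ
  ext a b
  have := congrArg (fun M : Matrix (Fin k) (Fin k) A => ((M a b : A) : F)) hxy
  simpa [σ] using this

lemma coordAlg_word {Γ A κ : Type*} [Group Γ] [CommRing A] [Fintype κ] [DecidableEq κ] {n : ℕ}
    (σ : Γ →* Matrix κ κ A) (w : FreeGroup (Fin n)) :
    ∀ a b, (fun g : Fin n → Γ => σ (FreeGroup.lift g w) a b) ∈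
      coordAlg (fun i : Fin n => σ.comp (Pi.evalMonoidHom (fun _ => Γ) i)) := by
  set τ := (fun i : Fin n => σ.comp (Pi.evalMonoidHom (fun _ => Γ) i)) with hτ
  induction w using FreeGroup.induction_on with
  | C1 =>
    intro a b
    simpa using coordAlg_const τ ((1 : Matrix κ κ A) a b)
  | of i =>
    intro a b
    have := coordAlg_entry τ i a b
    simpa [hτ] using this
  | inv_of i _ =>
    intro a b
    have := coordAlg_entry_inv τ i a b
    simpa [hτ] using this
  | mul x y hx hy =>
    intro a b
    simp only [map_mul, Matrix.mul_apply]
    exact coordAlg_sum τ _ fun c => (coordAlg τ).mul_mem (hx a c) (hy c b)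

lemma subgroup_pi_finiteIndex {Γ : Type*} [Group Γ] {n : ℕ} (S : Subgroup (Fin n → Γ))
    (hS : S.FiniteIndex) : ∃ N : Subgroup Γ, N.Normal ∧ N.FiniteIndex ∧
      ∀ u : Fin n → Γ, (∀ i, u i ∈ N) → u ∈ S := by
  let M : Subgroup Γ := ⨅ i, S.comap (MonoidHom.mulSingle (fun _ : Fin n => Γ) i)
  have hM : M.FiniteIndex := by
    apply Subgroup.finiteIndex_iInf
    intro i
    exact ⟨by
      rw [Subgroup.index_comap]
      exact fun h => hS.1 (Subgroup.index_eq_zero_of_relIndex_eq_zero h)⟩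
  refine ⟨M.normalCore, inferInstance, inferInstance, fun u hu => ?_⟩
  have h1 : ∀ i, Pi.mulSingle i (u i) ∈ S := by
    intro i
    have := Subgroup.mem_iInf.mp (M.normalCore_le (hu i)) i
    simpa using this
  have := Subgroup.pi_mem_of_mulSingle_mem (H := S) u h1
  exact this

theorem exists_coset_identity {Γ F : Type*} [Group Γ] [Group.FG Γ] [Field F] (k : ℕ)
    (ρ : Γ →* Matrix.GeneralLinearGroup (Fin k) F) (hρ : Function.Injective ρ)
    {n : ℕ} (w : FreeGroup (Fin n)) (hw : IsProbabilisticIdentity Γ w) :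
    ∃ N : Subgroup Γ, N.Normal ∧ N.FiniteIndex ∧ ∃ y : Fin n → Γ,
      ∀ u : Fin n → Γ, (∀ i, u i ∈ N) → FreeGroup.lift (y * u) w = 1 := by
  classical
  obtain ⟨A, σ, hft, hσ⟩ := exists_integral_model k ρ hρ
  have hN : IsNoetherianRing A := Algebra.FiniteType.isNoetherianRing ℤ A
  obtain ⟨m, hm⟩ := Ideal.exists_maximal A
  have hfin : Finite (A ⧸ m) := finite_residue m
  have hfinj : ∀ j, Finite (A ⧸ m ^ j) := fun j =>
    Ideal.finite_quotient_pow (IsNoetherian.noetherian m) j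
  let σj : ∀ j, Γ →* (Matrix (Fin k) (Fin k) (A ⧸ m ^ j))ˣ := fun j =>
    MonoidHom.toHomUnits (((Ideal.Quotient.mk (m ^ j)).mapMatrix.toMonoidHom).comp σ)
  have hσj : ∀ j g, g ∈ (σj j).ker → ∀ a b, σ g a b - (1 : Matrix (Fin k) (Fin k) A) a b ∈ m ^ j := by
    intro j g hg a b
    rw [MonoidHom.mem_ker] at hg
    have h1 := congrArg (fun M : (Matrix (Fin k) (Fin k) (A ⧸ m ^ j))ˣ => M.1 a b) hg
    simp only [σj, MonoidHom.coe_toHomUnits, MonoidHom.comp_apply, Units.val_one] at h1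
    change Ideal.Quotient.mk (m ^ j) (σ g a b) = _ at h1
    rw [← Ideal.Quotient.eq, h1, Matrix.one_apply, Matrix.one_apply]
    split_ifs <;> simp
  have hfi : ∀ j, (σj j).ker.FiniteIndex := fun j => inferInstance
  let τ := (fun i : Fin n => σ.comp (Pi.evalMonoidHom (fun _ => Γ) i))
  let φ : Fin k → Fin k → coordAlg τ := fun a b =>
    ⟨fun g => σ (FreeGroup.lift g w) a b - (1 : Matrix (Fin k) (Fin k) A) a b,
      (coordAlg τ).sub_mem (coordAlg_word σ w a b) (coordAlg_const τ _)⟩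
  let I₀ : Ideal (coordAlg τ) := Ideal.span (Set.range fun p : Fin k × Fin k => φ p.1 p.2)
  let X : ℕ → Type _ := fun j => Fin n → Γ ⧸ (σj j).ker
  have hXf : ∀ j, Finite (X j) := fun j => by
    have : Finite (Γ ⧸ (σj j).ker) := Subgroup.finite_quotient_of_finiteIndex
    exact Pi.finite
  let π : ∀ j, (Fin n → Γ) →* X j := fun j =>
    { toFun := fun g i => (g i : Γ ⧸ (σj j).ker)
      map_one' := rfl
      map_mul' := fun _ _ => rfl }
  obtain ⟨hw1, ε, hε, hprob⟩ := hw
  obtain ⟨S, hSfi, y, hy⟩ := coset_zero_of_density (coordEv τ) (coordEv_smul τ) (fun j => m ^ j)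
    (fun i j hij => Ideal.pow_le_pow_right hij)
    (by
      intro a ha
      have : a ∈ ⨅ j, m ^ j := by rw [Submodule.mem_iInf]; exact ha
      rwa [Ideal.iInf_pow_eq_bot_of_isDomain _ hm.ne_top] at this)
    X π
    (by
      intro j c
      choose g hg using fun i => QuotientGroup.mk_surjective (c i)
      exact ⟨g, funext hg⟩)
    I₀ ε hε
    (by
      intro j
      have h1 := hprob (σj j).ker inferInstance (hfi j)
      have : Finite (Γ ⧸ (σj j).ker) := Subgroup.finite_quotient_of_finiteIndex
      unfold wordProb at h1
      have hc : (0 : ℝ) < (Nat.card (Γ ⧸ (σj j).ker) : ℝ) ^ n := by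
        have : 0 < Nat.card (Γ ⧸ (σj j).ker) := Nat.card_pos
        positivity
      rw [le_div_iff₀ hc] at h1
      have h2 : (Nat.card (X j) : ℝ) = (Nat.card (Γ ⧸ (σj j).ker) : ℝ) ^ n := by
        simp [X, Nat.card_pi]
      rw [h2]
      refine h1.trans ?_
      rw [← Nat.card_coe_set_eq]
      norm_cast
      refine Nat.card_le_card_of_injective
        (fun c => (⟨c.1, ?_⟩ : levelSet (π j) (coordEv τ) (m ^ j) I₀)) ?_
      · intro g hg f hf
        have hle : I₀ ≤ Ideal.comap (coordEv τ g) (m ^ j) := by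
          rw [Ideal.span_le]
          rintro _ ⟨⟨a, b⟩, rfl⟩
          rw [SetLike.mem_coe, Ideal.mem_comap, coordEv_apply]
          refine hσj j _ ?_ a b
          rw [← QuotientGroup.eq_one_iff]
          have h3 : ((QuotientGroup.mk' (σj j).ker).comp (FreeGroup.lift g)) =
              FreeGroup.lift c.1 := by
            ext i
            simp only [MonoidHom.comp_apply, FreeGroup.lift_apply_of, ← hg]
            rfl
          have h4 := DFunLike.congr_fun h3 w
          rw [c.2] at h4
          exact h4
        exact hle hf
      · intro c c' hcc
        have hcc1 : c.1 = c'.1 :=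
          congrArg (fun t : levelSet (π j) (coordEv τ) (m ^ j) I₀ => t.1) hcc
        exact Subtype.ext hcc1)
  obtain ⟨N, hNn, hNf, hNS⟩ := subgroup_pi_finiteIndex S hSfi
  refine ⟨N, hNn, hNf, y, fun u hu => hσ ?_⟩
  rw [map_one]
  ext a b
  have := hy u (hNS u hu) (φ a b) (Ideal.subset_span ⟨(a, b), rfl⟩)
  rw [coordEv_apply] at this
  have := sub_eq_zero.mp this
  rw [this]

lemma mul_eq_zero_of_rank {d : ℕ} {κ : Type*} [Field κ] (A C Q : Matrix (Fin d) (Fin d) κ)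
    (hr : C.rank ≤ (C * Q).rank) (h0 : A * (C * Q) = 0) : A * C = 0 := by
  have hle : LinearMap.range (C * Q).mulVecLin ≤ LinearMap.range C.mulVecLin := by
    rw [Matrix.mulVecLin_mul]
    exact LinearMap.range_comp_le_range _ _
  have heq : LinearMap.range (C * Q).mulVecLin = LinearMap.range C.mulVecLin :=
    Submodule.eq_of_le_of_finrank_le hle hr
  have h1 : A.mulVecLin ∘ₗ C.mulVecLin = 0 := by
    ext x : 1
    apply LinearMap.ext
    intro y
    set v := (LinearMap.single κ (fun _ : Fin d => κ) x) y
    have hv : C.mulVecLin v ∈ LinearMap.range (C * Q).mulVecLin := by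
      rw [heq]; exact ⟨v, rfl⟩
    obtain ⟨u, hu⟩ := hv
    change A.mulVecLin (C.mulVecLin v) = 0
    rw [← hu, Matrix.mulVecLin_apply, Matrix.mulVecLin_apply, Matrix.mulVec_mulVec, h0]
    simp
  rw [← Matrix.mulVecLin_mul] at h1
  rw [← Matrix.toLin'_apply'] at h1
  exact (LinearEquiv.map_eq_zero_iff _).mp h1

section comb
variable {Γ T κ : Type*} [Group Γ] {N : Subgroup Γ} [N.Normal] [Field κ] {d : ℕ}

/-- pointwise conjugation -/
def cj (s : Γ) (ν : T → N) : T → N := fun t => MulAut.conjNormal s (ν t)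

lemma cj_mul (s : Γ) (ν μ : T → N) : cj s (ν * μ) = cj s ν * cj s μ := by
  funext t; simp [cj]

lemma cj_inv (s : Γ) (ν : T → N) : cj s ν⁻¹ = (cj s ν)⁻¹ := by
  funext t; simp [cj]

lemma cj_cj (s s' : Γ) (ν : T → N) : cj s (cj s' ν) = cj (s * s') ν := by
  funext t; simp [cj]

lemma cj_one (ν : T → N) : cj 1 ν = ν := by
  funext t; simp [cj]

lemma cj_const (s : Γ) (v : N) :
    cj s (fun _ : T => v) = fun _ => MulAut.conjNormal s v := rfl

lemma cj_N (m : N) (ν : T → N) :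
    cj (m : Γ) ν = (fun _ => m) * ν * (fun _ => m⁻¹) := by
  funext t; ext; simp [cj]

/-- Abstract data of leading terms. -/
structure LeadData (T : Type*) (N : Subgroup Γ) [N.Normal] (κ : Type*) [Field κ] (d : ℕ) where
  ld : (T → N) → Matrix (Fin d) (Fin d) κ
  R : N →* Matrix (Fin d) (Fin d) κ
  ne : ∀ ν, ld ν ≠ 0
  mul : ∀ ν μ, ld ν * ld μ ≠ 0 → ∃ c : κ, c ≠ 0 ∧ ld (ν * μ) = c • (ld ν * ld μ)
  const : ∀ v, ∃ c : κ, c ≠ 0 ∧ ld (fun _ => v) = c • R v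

variable (D : LeadData T N κ d)

lemma LeadData.R_inv (v : N) : D.R v * D.R v⁻¹ = 1 := by rw [← map_mul]; simp
lemma LeadData.R_inv' (v : N) : D.R v⁻¹ * D.R v = 1 := by rw [← map_mul]; simp

lemma LeadData.triple (a b : T → N) (v : N) (h : D.ld a * D.R v * D.ld b ≠ 0) :
    ∃ c : κ, c ≠ 0 ∧ D.ld (a * (fun _ => v) * b) = c • (D.ld a * D.R v * D.ld b) := by
  obtain ⟨c1, hc1, h1⟩ := D.const v
  have h2 : D.ld a * D.R v ≠ 0 := by intro h0; rw [h0, zero_mul] at h; exact h rfl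
  obtain ⟨c2, hc2, h3⟩ := D.mul a (fun _ => v) (by
    rw [h1, Matrix.mul_smul]; exact smul_ne_zero hc1 h2)
  rw [h1, Matrix.mul_smul, smul_smul] at h3
  obtain ⟨c3, hc3, h4⟩ := D.mul (a * fun _ => v) b (by
    rw [h3, Matrix.smul_mul]; exact smul_ne_zero (mul_ne_zero hc2 hc1) h)
  rw [h3, Matrix.smul_mul, smul_smul] at h4
  exact ⟨_, mul_ne_zero hc3 (mul_ne_zero hc2 hc1), h4⟩

lemma rank_smul_le {d : ℕ} (c : κ) (A : Matrix (Fin d) (Fin d) κ) : (c • A).rank ≤ A.rank := by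
  have : c • A = (c • (1 : Matrix (Fin d) (Fin d) κ)) * A := by simp
  rw [this]; exact Matrix.rank_mul_le_right _ _

lemma LeadData.conjN (m : N) (ν : T → N) :
    ∃ c : κ, c ≠ 0 ∧ D.ld (cj (m : Γ) ν) = c • (D.R m * D.ld ν * D.R m⁻¹) := by
  obtain ⟨c1, hc1, h1⟩ := D.const m
  obtain ⟨c2, hc2, h2⟩ := D.const m⁻¹
  have ha : D.R m * D.ld ν ≠ 0 := by
    intro h0
    apply D.ne ν
    rw [← one_mul (D.ld ν), ← D.R_inv' m, mul_assoc, h0, mul_zero]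
  have hb : D.R m * D.ld ν * D.R m⁻¹ ≠ 0 := by
    intro h0
    apply ha
    rw [← mul_one (D.R m * D.ld ν), ← D.R_inv' m, ← mul_assoc, h0, zero_mul]
  obtain ⟨c3, hc3, h3⟩ := D.mul (fun _ => m) ν (by
    rw [h1, Matrix.smul_mul]; exact smul_ne_zero hc1 ha)
  rw [h1, Matrix.smul_mul, smul_smul] at h3
  obtain ⟨c4, hc4, h4⟩ := D.mul ((fun _ => m) * ν) (fun _ => m⁻¹) (by
    rw [h3, h2, Matrix.smul_mul, Matrix.mul_smul]
    exact smul_ne_zero (mul_ne_zero hc3 hc1) (smul_ne_zero hc2 hb))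
  rw [h3, h2, Matrix.smul_mul, Matrix.mul_smul, smul_smul, smul_smul] at h4
  refine ⟨c4 * (c3 * c1) * c2, ?_, ?_⟩
  · simp [hc1, hc2, hc3, hc4]
  · rw [cj_N]; exact h4


/-- A choice of sign. -/
def zp (z : T → N) (ε : Bool) : T → N := if ε then z else z⁻¹

lemma rank_tr {d : ℕ} {A B C : Matrix (Fin d) (Fin d) κ} (c : κ) :
    (c • (A * B * C)).rank ≤ A.rank ∧ (c • (A * B * C)).rank ≤ C.rank :=
  ⟨((rank_smul_le _ _).trans (Matrix.rank_mul_le_left _ _)).trans (Matrix.rank_mul_le_left _ _),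
   (rank_smul_le _ _).trans (Matrix.rank_mul_le_right _ _)⟩

/-- genericity -/
def LeadData.Gen (F : Filter N) : Prop :=
  ∀ (A B : Matrix (Fin d) (Fin d) κ) (s : Γ), A ≠ 0 → B ≠ 0 →
    ∀ᶠ v in F, A * D.R (MulAut.conjNormal s v) * B ≠ 0 ∧
      A * D.R (MulAut.conjNormal s v⁻¹) * B ≠ 0

lemma exists_transversal [N.FiniteIndex] :
    ∃ S : Finset Γ, ∀ g : Γ, ∃ m : N, ∃ s ∈ S, g = m * s := by
  classical
  have : Finite (Γ ⧸ N) := Subgroup.finite_quotient_of_finiteIndex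
  have := Fintype.ofFinite (Γ ⧸ N)
  refine ⟨Finset.univ.image (Quotient.out : Γ ⧸ N → Γ), fun g => ?_⟩
  have h1 : g * (Quotient.out (g : Γ ⧸ N))⁻¹ ∈ N := by
    rw [← QuotientGroup.eq_one_iff]
    simp
  exact ⟨⟨_, h1⟩, Quotient.out (g : Γ ⧸ N), Finset.mem_image_of_mem _ (Finset.mem_univ _), by simp⟩

lemma LeadData.step2 (F : Filter N) [F.NeBot] (hF : D.Gen F) (r : ℕ)
    (hmin : ∀ ν, r ≤ (D.ld ν).rank) (x : T → N) (hx : (D.ld x).rank = r) (S : Finset Γ) :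
    ∃ z : T → N, ∀ s ∈ S, (D.ld (cj s z)).rank = r := by
  classical
  induction S using Finset.induction_on with
  | empty => exact ⟨x, by simp⟩
  | insert s0 S hs0 ih =>
    obtain ⟨z, hz⟩ := ih
    have hev : ∀ᶠ v in F, ∀ s ∈ insert s0 S,
        D.ld (cj s z) * D.R (MulAut.conjNormal s v) * D.ld (cj s (cj s0⁻¹ x)) ≠ 0 := by
      rw [Filter.eventually_all_finset]
      intro s _
      exact (hF _ _ s (D.ne _) (D.ne _)).mono fun v hv => hv.1
    obtain ⟨v, hv⟩ := hev.exists
    refine ⟨z * (fun _ => v) * cj s0⁻¹ x, fun s hs => le_antisymm ?_ (hmin _)⟩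
    rw [cj_mul, cj_mul, cj_const]
    obtain ⟨c, -, hc⟩ := D.triple _ _ _ (hv s hs)
    rw [hc]
    rcases Finset.mem_insert.mp hs with rfl | hs
    · refine (rank_tr c).2.trans ?_
      rw [cj_cj, mul_inv_cancel, cj_one, hx]
    · exact (rank_tr c).1.trans (hz s hs).le

lemma LeadData.step3 [N.FiniteIndex] (F : Filter N) [F.NeBot] (hF : D.Gen F) (r : ℕ)
    (hmin : ∀ ν, r ≤ (D.ld ν).rank) (x : T → N) (hx : (D.ld x).rank = r) :
    ∃ z : T → N, ∀ g ε, (D.ld (cj g (zp z ε))).rank = r := by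
  classical
  obtain ⟨S, hS⟩ := exists_transversal (N := N)
  obtain ⟨z, hz⟩ := D.step2 F hF r hmin x hx S
  have hev : ∀ᶠ v in F, ∀ s ∈ S,
      D.ld (cj s z) * D.R (MulAut.conjNormal s v) * D.ld (cj s z⁻¹) ≠ 0 ∧
      D.ld (cj s z) * D.R (MulAut.conjNormal s v⁻¹) * D.ld (cj s z⁻¹) ≠ 0 := by
    rw [Filter.eventually_all_finset]
    intro s _
    exact hF _ _ s (D.ne _) (D.ne _)
  obtain ⟨v, hv⟩ := hev.exists
  refine ⟨z * (fun _ => v) * z⁻¹, fun g ε => le_antisymm ?_ (hmin _)⟩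
  obtain ⟨m, s, hs, rfl⟩ := hS g
  rw [← cj_cj]
  obtain ⟨c, -, hc⟩ := D.conjN m (cj s (zp (z * (fun _ => v) * z⁻¹) ε))
  rw [hc]
  refine ((rank_smul_le _ _).trans (Matrix.rank_mul_le_left _ _)).trans
    ((Matrix.rank_mul_le_right _ _).trans ?_)
  cases ε
  · have : zp (z * (fun _ => v) * z⁻¹) false = z * (fun _ => v⁻¹) * z⁻¹ := by
      funext t; simp [zp, mul_assoc]
    rw [this, cj_mul, cj_mul, cj_const]
    obtain ⟨c, -, hc⟩ := D.triple _ _ _ (hv s hs).2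
    rw [hc]
    exact (rank_tr c).1.trans (hz s hs).le
  · have : zp (z * (fun _ => v) * z⁻¹) true = z * (fun _ => v) * z⁻¹ := rfl
    rw [this, cj_mul, cj_mul, cj_const]
    obtain ⟨c, -, hc⟩ := D.triple _ _ _ (hv s hs).1
    rw [hc]
    exact (rank_tr c).1.trans (hz s hs).le

/-- good transitions -/
def LeadData.Good (z : T → N) (g : Γ) : Prop :=
  ∀ h ε δ, D.ld (cj h (zp z ε)) * D.ld (cj (h * g) (zp z δ)) ≠ 0

lemma LeadData.good_of (z : T → N) (S : Finset Γ) (hS : ∀ g : Γ, ∃ m : N, ∃ s ∈ S, g = m * s)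
    (p q : Γ) (v : N)
    (hv : ∀ s ∈ S, ∀ ε δ, D.ld (cj s (zp z ε)) * D.R (MulAut.conjNormal (s * p) v) *
      D.ld (cj (s * p * q) (zp z δ)) ≠ 0) : D.Good z (p * v * q) := by
  intro h ε δ h0
  obtain ⟨m, s, hs, rfl⟩ := hS h
  apply hv s hs ε δ
  have e1 : (m : Γ) * s * (p * v * q) =
      m * (((MulAut.conjNormal (s * p) v : N) : Γ) * (s * p * q)) := by
    simp; group
  rw [e1, ← cj_cj, ← cj_cj (m : Γ), ← cj_cj ((MulAut.conjNormal (s * p) v : N) : Γ)] at h0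
  obtain ⟨c1, hc1, h1⟩ := D.conjN m (cj s (zp z ε))
  obtain ⟨c2, hc2, h2⟩ := D.conjN m (cj ((MulAut.conjNormal (s * p) v : N) : Γ)
    (cj (s * p * q) (zp z δ)))
  obtain ⟨c3, hc3, h3⟩ := D.conjN (MulAut.conjNormal (s * p) v) (cj (s * p * q) (zp z δ))
  rw [h1, h2, h3] at h0
  set A := D.ld (cj s (zp z ε))
  set B := D.ld (cj (s * p * q) (zp z δ))
  set V := MulAut.conjNormal (s * p) v
  have h4 : (c1 * c2 * c3) • (D.R m * (A * D.R V * B) * (D.R V⁻¹ * D.R m⁻¹)) = 0 := by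
    rw [← h0]
    simp only [Matrix.mul_smul, Matrix.smul_mul, smul_smul]
    congr 1
    · ring
    · have := D.R_inv' m
      calc _ = D.R m * A * 1 * D.R V * B * D.R V⁻¹ * D.R m⁻¹ := by noncomm_ring
        _ = _ := by rw [← this]; noncomm_ring
  have h5 := (smul_eq_zero.mp h4).resolve_left (by simp [hc1, hc2, hc3])
  calc A * D.R V * B = (D.R m⁻¹ * D.R m) * (A * D.R V * B) * (D.R V⁻¹ * (D.R m⁻¹ * D.R m) * D.R V) := by
        rw [D.R_inv', mul_one, D.R_inv', one_mul, mul_one]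
    _ = D.R m⁻¹ * (D.R m * (A * D.R V * B) * (D.R V⁻¹ * D.R m⁻¹)) * (D.R m * D.R V) := by
        noncomm_ring
    _ = 0 := by rw [h5]; simp

lemma LeadData.good_ev [N.FiniteIndex] (F : Filter N) (hF : D.Gen F) (z : T → N) (p q : Γ) :
    ∀ᶠ v : N in F, D.Good z (p * v * q) ∧ D.Good z (p * ((v⁻¹ : N) : Γ) * q) := by
  obtain ⟨S, hS⟩ := exists_transversal (N := N)
  have hev : ∀ᶠ v in F, ∀ s ∈ S, ∀ ε δ,
      D.ld (cj s (zp z ε)) * D.R (MulAut.conjNormal (s * p) v) *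
        D.ld (cj (s * p * q) (zp z δ)) ≠ 0 ∧
      D.ld (cj s (zp z ε)) * D.R (MulAut.conjNormal (s * p) v⁻¹) *
        D.ld (cj (s * p * q) (zp z δ)) ≠ 0 := by
    rw [Filter.eventually_all_finset]
    intro s _
    rw [Filter.eventually_all]
    intro ε
    rw [Filter.eventually_all]
    intro δ
    exact hF _ _ _ (D.ne _) (D.ne _)
  filter_upwards [hev] with v hv
  exact ⟨D.good_of z S hS p q v fun s hs ε δ => (hv s hs ε δ).1,
    D.good_of z S hS p q v⁻¹ fun s hs ε δ => (hv s hs ε δ).2⟩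

lemma LeadData.step4 [N.FiniteIndex] {L : Type*} [DecidableEq L] (F : Filter N) [F.NeBot]
    (hF : D.Gen F) (z : T → N) (b : L → Γ) (S : Finset L) :
    ∃ v : L → N, ∀ i ∈ S, ∀ j ∈ S, i ≠ j →
      D.Good z ((b i * v i)⁻¹ * (b j * v j)) := by
  induction S using Finset.induction_on with
  | empty => exact ⟨fun _ => 1, by simp⟩
  | insert a S ha ih =>
    obtain ⟨v, hv⟩ := ih
    have hev : ∀ᶠ u : N in F, ∀ i ∈ S, (D.Good z (((b i * v i)⁻¹ * b a) * u * 1)) ∧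
        D.Good z (1 * ((u⁻¹ : N) : Γ) * ((b a)⁻¹ * (b i * v i))) := by
      rw [Filter.eventually_all_finset]
      intro i _
      exact ((D.good_ev F hF z _ _).mono fun v hv => hv.1).and
        ((D.good_ev F hF z _ _).mono fun v hv => hv.2)
    obtain ⟨u, hu⟩ := hev.exists
    refine ⟨Function.update v a u, ?_⟩
    have hne : ∀ i ∈ S, i ≠ a := fun i hi h => ha (h ▸ hi)
    intro i hi' j hj' hij
    rcases Finset.mem_insert.mp hi' with rfl | hi
    · rcases Finset.mem_insert.mp hj' with rfl | hj
      · exact absurd rfl hij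
      · rw [Function.update_self, Function.update_of_ne (hne j hj)]
        have := (hu j hj).2
        convert this using 1
        simp [mul_assoc]
    · rcases Finset.mem_insert.mp hj' with rfl | hj
      · rw [Function.update_self, Function.update_of_ne (hne i hi)]
        have := (hu i hi).1
        convert this using 1
        simp [mul_assoc]
      · rw [Function.update_of_ne (hne i hi), Function.update_of_ne (hne j hj)]
        exact hv i hi j hj hij

lemma LeadData.step5 {n : ℕ} (r : ℕ) (hmin : ∀ ν, r ≤ (D.ld ν).rank) (z : T → N)
    (hz : ∀ g ε, (D.ld (cj g (zp z ε))).rank = r) (e : Fin n × Bool → Γ)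
    (he : ∀ i j, i ≠ j → D.Good z ((e i)⁻¹ * e j))
    (f : T → Fin n × Bool → Γ)
    (hf : ∀ t a, f t a = e a * (zp z a.2 t : N) * (e (a.1, !a.2))⁻¹)
    (l : List (Fin n × Bool)) : ∀ a, FreeGroup.IsReduced (a :: l) → ∀ h : Γ,
      ∃ (k : Γ) (ν : T → N), (∀ t, (ν t : Γ) = h * (e a)⁻¹ * ((a :: l).map (f t)).prod * k) ∧
        ∃ Q, D.ld ν = D.ld (cj h (zp z a.2)) * Q := by
  induction l with
  | nil =>
    intro a _ h
    refine ⟨e (a.1, !a.2) * h⁻¹, cj h (zp z a.2), ?_, 1, by simp⟩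
    intro t
    simp only [cj, MulAut.conjNormal_apply, List.map_cons, List.map_nil, List.prod_cons,
      List.prod_nil, hf]
    group
  | cons b l ih =>
    intro a hred h
    have hred' : FreeGroup.IsReduced (b :: l) := by
      rw [FreeGroup.isReduced_cons_cons] at hred
      exact hred.2
    have hab : a.1 = b.1 → a.2 = b.2 := by
      rw [FreeGroup.isReduced_cons_cons] at hred
      exact hred.1
    obtain ⟨k, ν, hν, Q, hQ⟩ := ih b hred' (h * ((e (a.1, !a.2))⁻¹ * e b))
    have hne : (a.1, !a.2) ≠ b := by
      rintro rfl
      simp at hab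
    have h1 : D.ld (cj h (zp z a.2)) * D.ld ν ≠ 0 := by
      intro h0
      rw [hQ] at h0
      refine he _ _ hne h a.2 b.2 (mul_eq_zero_of_rank _ _ Q ?_ h0)
      rw [hz, ← hQ]
      exact hmin _
    obtain ⟨c, hc, h2⟩ := D.mul _ _ h1
    refine ⟨k, cj h (zp z a.2) * ν, ?_, c • D.ld ν, by rw [h2, Matrix.mul_smul]⟩
    intro t
    rw [Pi.mul_apply, Subgroup.coe_mul, hν t]
    rw [List.map_cons (l := b :: l), List.prod_cons (l := List.map (f t) (b :: l)), hf t a]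
    simp only [cj, MulAut.conjNormal_apply]
    group

theorem LeadData.contra [N.FiniteIndex] [Nonempty T] (F : Filter N) [F.NeBot]
    (hF : D.Gen F) (x0 : T → N) (hx0 : ¬ IsUnit (D.ld x0)) {n : ℕ} (w : FreeGroup (Fin n))
    (hw : w ≠ 1) (y : Fin n → Γ)
    (hy : ∀ u : Fin n → Γ, (∀ i, u i ∈ N) → FreeGroup.lift (y * u) w = 1) : False := by
  classical
  obtain ⟨x, hx⟩ : ∃ x : T → N, ∀ ν, (D.ld x).rank ≤ (D.ld ν).rank := by
    have hne : (Set.range fun ν => (D.ld ν).rank).Nonempty := Set.range_nonempty _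
    obtain ⟨x, hx⟩ := Nat.sInf_mem hne
    refine ⟨x, fun ν => ?_⟩
    simp only at hx
    rw [hx]
    exact Nat.sInf_le ⟨ν, rfl⟩
  set r := (D.ld x).rank with hr
  have hrd : r < d := by
    refine (hx x0).trans_lt (lt_of_le_of_ne (by simpa using (D.ld x0).rank_le_width) ?_)
    intro h
    apply hx0
    rw [← Matrix.mulVec_surjective_iff_isUnit]
    have h1 : LinearMap.range (D.ld x0).mulVecLin = ⊤ := by
      apply Submodule.eq_top_of_finrank_eq
      rw [Module.finrank_fin_fun]
      exact h
    exact LinearMap.range_eq_top.mp h1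
  obtain ⟨z, hz⟩ := D.step3 F hF r hx x rfl
  let b : Fin n × Bool → Γ := fun a => if a.2 then y a.1 else 1
  obtain ⟨v, hv⟩ := D.step4 F hF z b Finset.univ
  let e : Fin n × Bool → Γ := fun a => b a * v a
  let X : T → Fin n → Γ := fun t j => e (j, true) * (z t : Γ) * (e (j, false))⁻¹
  let f : T → Fin n × Bool → Γ := fun t a => cond a.2 (X t a.1) (X t a.1)⁻¹
  have hf : ∀ t a, f t a = e a * (zp z a.2 t : N) * (e (a.1, !a.2))⁻¹ := by
    rintro t ⟨j, ε⟩
    cases ε <;> simp [f, X, zp, mul_assoc]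
  have hX : ∀ t, FreeGroup.lift (X t) w = 1 := by
    intro t
    have := hy (fun j => ((v (j, true) * z t * (v (j, false))⁻¹ : N) : Γ)) (fun i => Subtype.prop _)
    convert this using 2
    congr 1
    funext j
    simp [X, e, b, mul_assoc]
  have hnil : w.toWord ≠ [] := by
    intro h
    exact hw (FreeGroup.toWord_eq_nil_iff.mp h)
  obtain ⟨a, l, hal⟩ := List.exists_cons_of_ne_nil hnil
  have hred : FreeGroup.IsReduced (a :: l) := by
    rw [← hal]; exact FreeGroup.isReduced_toWord
  obtain ⟨k, ν, hν, Q, hQ⟩ := D.step5 r hx z hz e (fun i j hij => hv i (Finset.mem_univ _) j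
    (Finset.mem_univ _) hij) f hf l a hred 1
  have hprod : ∀ t, ((a :: l).map (f t)).prod = 1 := by
    intro t
    rw [← hX t, ← hal]
    conv_rhs => rw [← FreeGroup.mk_toWord (x := w), FreeGroup.lift_mk]
  obtain ⟨t0⟩ := ‹Nonempty T›
  have hνc : ν = fun _ => ν t0 := by
    funext t
    ext
    rw [hν t, hν t0, hprod, hprod]
  obtain ⟨c, hc, h1⟩ := D.const (ν t0)
  rw [← hνc] at h1
  have h2 : IsUnit (D.ld ν) := by
    rw [h1]
    refine IsUnit.of_mul_eq_one (c⁻¹ • D.R (ν t0)⁻¹) ?_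
    rw [Matrix.smul_mul, Matrix.mul_smul, smul_smul, mul_inv_cancel₀ hc, D.R_inv, one_smul]
  have h3 : (D.ld ν).rank = d := by
    have := Matrix.rank_of_isUnit _ h2
    simpa using this
  have h4 : (D.ld ν).rank ≤ r := by
    rw [hQ, ← hz 1 a.2]
    exact Matrix.rank_mul_le_left _ _
  omega

end comb

lemma exists_valuation_of_not_mem {K L : Type*} [Field K] [IsAlgClosed K] [Field L]
    (ι : K →+* L) (x : L) (hx : ∀ c, ι c ≠ x) :
    ∃ O : ValuationSubring L, (∀ c, ι c ∈ O) ∧ x ∉ O := by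
  let _ : Algebra K L := ι.toAlgebra
  have hxR : x ∉ (integralClosure K L).toSubring := by
    intro h
    have hi : IsIntegral K x := h
    have h1 := IsAlgClosed.degree_eq_one_of_irreducible K (minpoly.irreducible hi)
    obtain ⟨c, hc⟩ := minpoly.mem_range_of_degree_eq_one K x h1
    exact hx c hc
  obtain ⟨V, hV, hxV⟩ := Subring.exists_le_valuationSubring_of_isIntegrallyClosedIn hxR
  refine ⟨V, fun c => hV ?_, hxV⟩
  exact (integralClosure K L).algebraMap_mem c

section lead
variable {L : Type*} [Field L] (O : ValuationSubring L) {d : ℕ}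

/-- `A` is a leading term of the matrix `X`. -/
def IsLead (X : Matrix (Fin d) (Fin d) L)
    (A : Matrix (Fin d) (Fin d) (IsLocalRing.ResidueField O)) : Prop :=
  ∃ s : L, s ≠ 0 ∧ ∃ Y : Matrix (Fin d) (Fin d) O,
    X = s • O.subtype.mapMatrix Y ∧ (IsLocalRing.residue O).mapMatrix Y = A

lemma IsLead.mul {X Y A B} (hX : IsLead O (d := d) X A) (hY : IsLead O Y B) :
    IsLead O (X * Y) (A * B) := by
  obtain ⟨s, hs, X', rfl, rfl⟩ := hX
  obtain ⟨t, ht, Y', rfl, rfl⟩ := hY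
  refine ⟨s * t, mul_ne_zero hs ht, X' * Y', ?_, ?_⟩
  · rw [map_mul, Matrix.smul_mul, Matrix.mul_smul, smul_smul]
  · rw [map_mul]

lemma isLead_exists (X : Matrix (Fin d) (Fin d) L) (hX : X ≠ 0) : ∃ A, A ≠ 0 ∧ IsLead O X A := by
  have hne : Nonempty (Fin d × Fin d) := by
    by_contra h
    apply hX
    ext i j
    exact absurd ⟨(i, j)⟩ h
  obtain ⟨⟨i, j⟩, hij⟩ := Finite.exists_max (fun p : Fin d × Fin d => O.valuation (X p.1 p.2))
  have h0 : X i j ≠ 0 := by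
    intro h0
    apply hX
    ext a b
    have := hij (a, b)
    simp only [h0, map_zero, le_zero_iff, map_eq_zero] at this
    simpa using this
  have hmem : ∀ a b, (X i j)⁻¹ * X a b ∈ O := by
    intro a b
    rw [← O.valuation_le_one_iff, map_mul, map_inv₀]
    have hp : 0 < O.valuation (X i j) := by
      rw [zero_lt_iff]; simpa using h0
    rw [inv_mul_le_iff₀ hp, mul_one]
    exact hij (a, b)
  refine ⟨_, ?_, X i j, h0, Matrix.of fun a b => ⟨_, hmem a b⟩, ?_, rfl⟩
  · intro h
    have := congrFun (congrFun h i) j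
    simp only [RingHom.mapMatrix_apply, Matrix.map_apply, Matrix.of_apply, Matrix.zero_apply] at this
    have h1 : (⟨(X i j)⁻¹ * X i j, hmem i j⟩ : O) = 1 := by
      ext; simp [h0]
    rw [h1, map_one] at this
    exact one_ne_zero this
  · ext a b
    simp [h0]

lemma IsLead.unique {X A B} (hA : IsLead O (d := d) X A) (hB : IsLead O X B) (hA0 : A ≠ 0)
    (hB0 : B ≠ 0) : ∃ c : IsLocalRing.ResidueField O, c ≠ 0 ∧ B = c • A := by
  obtain ⟨s, hs, X', h1, rfl⟩ := hA
  obtain ⟨t, ht, Y', h2, rfl⟩ := hB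
  have key : ∀ (s t : L) (X' Y' : Matrix (Fin d) (Fin d) O), s ≠ 0 → t ≠ 0 →
      s • O.subtype.mapMatrix X' = t • O.subtype.mapMatrix Y' → t⁻¹ * s ∈ O →
      ∃ c : IsLocalRing.ResidueField O, (IsLocalRing.residue O).mapMatrix Y' = c • (IsLocalRing.residue O).mapMatrix X' := by
    intro s t X' Y' hs ht h hm
    refine ⟨IsLocalRing.residue O ⟨_, hm⟩, ?_⟩
    have : Y' = (⟨_, hm⟩ : O) • X' := by
      ext a b
      have := congrFun (congrFun h a) b
      simp only [Matrix.smul_apply, RingHom.mapMatrix_apply, Matrix.map_apply, smul_eq_mul] at this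
      simp only [Matrix.smul_apply, smul_eq_mul]
      change O.subtype _ = O.subtype (_ * _)
      rw [map_mul]
      change _ = t⁻¹ * s * _
      rw [mul_assoc, this, inv_mul_cancel_left₀ ht]
    conv_lhs => rw [this]
    ext a b
    simp
  have h := h1.symm.trans h2
  rcases O.mem_or_inv_mem (t⁻¹ * s) with hm | hm
  · obtain ⟨c, hc⟩ := key s t X' Y' hs ht h hm
    refine ⟨c, ?_, hc⟩
    rintro rfl
    exact hB0 (by rw [hc, zero_smul])
  · rw [mul_inv, inv_inv, mul_comm] at hm
    obtain ⟨c, hc⟩ := key t s Y' X' ht hs h.symm hm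
    have hc0 : c ≠ 0 := by
      rintro rfl
      exact hA0 (by rw [hc, zero_smul])
    exact ⟨c⁻¹, inv_ne_zero hc0, by rw [hc, smul_smul, inv_mul_cancel₀ hc0, one_smul]⟩

lemma IsLead.entry_mem {X Y A B} (hX : IsLead O (d := d) X A) (hY : IsLead O Y B)
    (hXY : X * Y = 1) (hA : IsUnit A) (hB : B ≠ 0) (a b c e : Fin d) : X a b * Y c e ∈ O := by
  obtain ⟨s, hs, X', rfl, rfl⟩ := hX
  obtain ⟨t, ht, Y', rfl, rfl⟩ := hY
  have hst : s * t ≠ 0 := mul_ne_zero hs ht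
  rw [Matrix.smul_mul, Matrix.mul_smul, smul_smul, ← map_mul] at hXY
  have hval : ∀ i j, s * t * ((X' * Y') i j : O) = (1 : Matrix (Fin d) (Fin d) L) i j := by
    intro i j
    rw [← hXY]; simp
  have hinv : (s * t)⁻¹ ∈ O := by
    have := hval a a
    rw [Matrix.one_apply_eq] at this
    rw [inv_eq_of_mul_eq_one_right this]
    exact Subtype.prop _
  have hXY' : X' * Y' = (⟨_, hinv⟩ : O) • (1 : Matrix (Fin d) (Fin d) O) := by
    ext i j
    have := hval i j
    rw [mul_comm, ← eq_mul_inv_iff_mul_eq₀ hst] at this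
    rw [this]
    simp only [Matrix.smul_apply, smul_eq_mul, Matrix.one_apply]
    split_ifs <;> simp
  have hu : IsLocalRing.residue O ⟨_, hinv⟩ ≠ 0 := by
    intro h0
    apply hB
    rw [← hA.mul_right_eq_zero, ← map_mul, hXY']
    ext i j
    rw [RingHom.mapMatrix_apply, Matrix.map_apply, Matrix.smul_apply, smul_eq_mul, map_mul, h0,
      zero_mul, Matrix.zero_apply]
  rw [ne_eq, IsLocalRing.residue_eq_zero_iff, IsLocalRing.mem_maximalIdeal, mem_nonunits_iff,
    not_not] at hu
  obtain ⟨u, hu⟩ := hu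
  have hstO : s * t ∈ O := by
    have h1 : ((u⁻¹ : Oˣ) : O) * (u : O) = 1 := by simp
    rw [hu] at h1
    have h2 := congrArg O.subtype h1
    rw [map_mul, map_one] at h2
    have h3 : O.subtype ((u⁻¹ : Oˣ) : O) * (s * t)⁻¹ = 1 := h2
    have h4 := (mul_inv_eq_one₀ hst).mp h3
    rw [← h4]
    exact Subtype.prop _
  have : (s • O.subtype.mapMatrix X') a b * (t • O.subtype.mapMatrix Y') c e =
      (s * t) * ((X' a b : L) * (Y' c e : L)) := by
    simp only [Matrix.smul_apply, RingHom.mapMatrix_apply, Matrix.map_apply, smul_eq_mul]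
    change s * (X' a b : L) * (t * (Y' c e : L)) = _
    ring
  rw [this]
  exact O.mul_mem _ _ hstO (O.mul_mem _ _ (Subtype.prop _) (Subtype.prop _))
end lead

theorem contra_of_ultrafilter {Γ K : Type*} [Group Γ] {N : Subgroup Γ} [N.Normal]
    [N.FiniteIndex] [Field K] [IsAlgClosed K] {d : ℕ} (ρ : N →* Matrix (Fin d) (Fin d) K)
    (U : Ultrafilter N)
    (h1 : ∀ (W : Submodule K (Matrix (Fin d) (Fin d) K)) (s : Γ), W ≠ ⊤ →
      ∀ᶠ v in (U : Filter N), ρ (MulAut.conjNormal s v) ∉ W ∧ ρ (MulAut.conjNormal s v⁻¹) ∉ W)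
    (a b c e : Fin d)
    (h2 : ∀ t : K, ∀ᶠ v in (U : Filter N), ρ v a b * ρ v⁻¹ c e ≠ t)
    {n : ℕ} (w : FreeGroup (Fin n))
    (hw : w ≠ 1) (y : Fin n → Γ)
    (hy : ∀ u : Fin n → Γ, (∀ i, u i ∈ N) → FreeGroup.lift (y * u) w = 1) : False := by
  classical
  let L := Filter.Germ (U : Filter N) K
  let q : (N → K) →+* L := Filter.Germ.coeRingHom (U : Filter N)
  let ι : K →+* L := q.comp (Pi.constRingHom N K)
  have hq : ∀ f g : N → K, q f = q g ↔ ∀ᶠ v in (U : Filter N), f v = g v := by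
    intro f g
    exact Filter.Germ.coe_eq
  let Φ : (N → N) →* Matrix (Fin d) (Fin d) L :=
    { toFun := fun ν => Matrix.of fun i j => q fun v => ρ (ν v) i j
      map_one' := by
        ext i j
        simp only [Pi.one_apply, map_one, Matrix.of_apply, Matrix.one_apply]
        split_ifs
        · exact map_one q
        · exact map_zero q
      map_mul' := by
        intro ν μ
        ext i j
        simp only [Pi.mul_apply, map_mul, Matrix.of_apply, Matrix.mul_apply]
        simp only [← map_mul, ← map_sum]
        congr 1
        funext v
        simp }
  have hΦ : ∀ ν i j, Φ ν i j = q fun v => ρ (ν v) i j := fun _ _ _ => rfl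
  have hΦne : ∀ ν, Φ ν ≠ 0 := by
    intro ν h0
    have h3 : Φ ν * Φ ν⁻¹ = 1 := by rw [← map_mul, mul_inv_cancel, map_one]
    rw [h0, zero_mul] at h3
    have := congrFun (congrFun h3 a) a
    rw [Matrix.zero_apply, Matrix.one_apply_eq] at this
    exact zero_ne_one this
  obtain ⟨O, hO, hxO⟩ := exists_valuation_of_not_mem ι (q fun v => ρ v a b * ρ v⁻¹ c e) (by
    intro t ht
    have h3 := (hq _ _).mp ht
    obtain ⟨v, hv, hv'⟩ := (h3.and (h2 t)).exists
    exact hv' hv.symm)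
  choose ld hld0 hld using fun ν => isLead_exists O (Φ ν) (hΦne ν)
  let j : K →+* O := ι.codRestrict O.toSubring hO
  let π : K →+* IsLocalRing.ResidueField O := (IsLocalRing.residue O).comp j
  have hc : ∀ v, IsLead O (Φ fun _ => v) (π.mapMatrix (ρ v)) := by
    intro v
    refine ⟨1, one_ne_zero, j.mapMatrix (ρ v), ?_, ?_⟩
    · rw [one_smul]
      rfl
    · rfl
  let D : LeadData N N (IsLocalRing.ResidueField O) d :=
    { ld := ld
      R := π.mapMatrix.toMonoidHom.comp ρ
      ne := hld0
      mul := by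
        intro ν μ h
        have h3 := (hld ν).mul O (hld μ)
        rw [← map_mul] at h3
        exact h3.unique O (hld _) h (hld0 _)
      const := by
        intro v
        refine (hc v).unique O (hld _) ?_ (hld0 _)
        intro h0
        have h3 : π.mapMatrix (ρ v) * π.mapMatrix (ρ v⁻¹) = 1 := by
          rw [← map_mul, ← map_mul, mul_inv_cancel, map_one, map_one]
        rw [h0, zero_mul] at h3
        have := congrFun (congrFun h3 a) a
        rw [Matrix.zero_apply, Matrix.one_apply_eq] at this
        exact zero_ne_one this }
  refine D.contra (U : Filter N) ?_ id ?_ w hw y hy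
  · intro A B s hA hB
    let W : Submodule K (Matrix (Fin d) (Fin d) K) :=
      { carrier := {X | A * π.mapMatrix X * B = 0}
        add_mem' := by
          intro X Y hX hY
          simp only [Set.mem_ofPred_eq] at hX hY ⊢
          rw [map_add, mul_add, add_mul, hX, hY, add_zero]
        zero_mem' := by simp
        smul_mem' := by
          intro t X hX
          simp only [Set.mem_ofPred_eq] at hX ⊢
          have : π.mapMatrix (t • X) = π t • π.mapMatrix X := by
            ext i k; simp
          rw [this, Matrix.mul_smul, Matrix.smul_mul, hX, smul_zero] }
    have hW : W ≠ ⊤ := by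
      intro htop
      obtain ⟨i, k, hik⟩ : ∃ i k, A i k ≠ 0 := by
        by_contra! h; exact hA (by ext i k; exact h i k)
      obtain ⟨l, m, hlm⟩ : ∃ i k, B i k ≠ 0 := by
        by_contra! h; exact hB (by ext i k; exact h i k)
      have h3 : Matrix.single k l (1 : K) ∈ W := by rw [htop]; trivial
      have h4 : A * π.mapMatrix (Matrix.single k l (1 : K)) * B = 0 := h3
      have h5 := congrFun (congrFun h4 i) m
      have h6 : π.mapMatrix (Matrix.single k l (1 : K)) = Matrix.single k l 1 := by
        rw [RingHom.mapMatrix_apply, Matrix.map_single, map_one]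
      rw [h6, Matrix.zero_apply, Matrix.mul_apply, Finset.sum_eq_single l] at h5
      · simp at h5
        tauto
      · intro o _ ho
        rw [Matrix.mul_single_apply_of_ne, zero_mul]
        exact ho
      · simp
    filter_upwards [h1 W s hW] with v hv
    exact hv
  · intro hu
    have h3 : Φ id * Φ (id : N → N)⁻¹ = 1 := by rw [← map_mul, mul_inv_cancel, map_one]
    have h4 := (hld id).entry_mem O (hld (id : N → N)⁻¹) h3 hu (hld0 _) a b c e
    rw [hΦ, hΦ, ← map_mul] at h4
    exact hxO h4

open scoped commutatorElement in
lemma units_solvable_of_nilpotent {A : Type*} [Ring A] (J : Ideal A) [J.IsTwoSided] (m : ℕ)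
    (hm : J ^ m = ⊥) (hcomm : ∀ x y : A, x * y - y * x ∈ J) : Group.IsSolvable Aˣ := by
  let U : ℕ → Subgroup Aˣ := fun i =>
    { carrier := {u | (u : A) - 1 ∈ J ^ i}
      mul_mem' := by
        intro a b ha hb
        simp only [Set.mem_ofPred_eq] at ha hb ⊢
        have : ((a * b : Aˣ) : A) - 1 = a * ((b : A) - 1) + ((a : A) - 1) := by
          rw [Units.val_mul]; noncomm_ring
        rw [this]
        exact (J ^ i).add_mem ((J ^ i).mul_mem_left _ hb) ha
      one_mem' := by simp
      inv_mem' := by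
        intro a ha
        simp only [Set.mem_ofPred_eq] at ha ⊢
        have : ((a⁻¹ : Aˣ) : A) - 1 = (-((a⁻¹ : Aˣ) : A)) * ((a : A) - 1) := by
          rw [mul_sub, neg_mul, Units.inv_mul]; noncomm_ring
        rw [this]
        exact (J ^ i).mul_mem_left _ ha }
  have hU : ∀ i u, u ∈ U i ↔ (u : A) - 1 ∈ J ^ i := fun _ _ => Iff.rfl
  have key : ∀ a b : Aˣ, ((⁅a, b⁆ : Aˣ) : A) - 1 =
      (a * b) * (((a⁻¹ : Aˣ) : A) * ((b⁻¹ : Aˣ) : A) - ((b⁻¹ : Aˣ) : A) * ((a⁻¹ : Aˣ) : A)) := by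
    intro a b
    rw [commutatorElement_def, mul_sub]
    simp [mul_assoc]
  have hD : ∀ i, derivedSeries Aˣ (i + 1) ≤ U (i + 1) := by
    intro i
    induction i with
    | zero =>
      rw [derivedSeries_succ, Subgroup.commutator_le]
      intro a _ b _
      rw [hU, key, zero_add, Submodule.pow_one]
      exact J.mul_mem_left _ (hcomm _ _)
    | succ i ih =>
      rw [derivedSeries_succ, Subgroup.commutator_le]
      intro a ha b hb
      have hx := (hU _ _).mp ((U (i + 1)).inv_mem (ih ha))
      have hy := (hU _ _).mp ((U (i + 1)).inv_mem (ih hb))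
      have hle : J ^ (i + 1) ≤ J := by
        have := Ideal.pow_le_pow_right (I := J) (show 1 ≤ i + 1 by omega)
        rwa [Submodule.pow_one] at this
      rw [hU, key]
      apply Ideal.mul_mem_left
      set x := ((a⁻¹ : Aˣ) : A)
      set y := ((b⁻¹ : Aˣ) : A)
      have e : x * y - y * x = (x - 1) * (y - 1) - (y - 1) * (x - 1) := by noncomm_ring
      rw [e, Submodule.pow_succ]
      exact Ideal.sub_mem _ (Ideal.mul_mem_mul hx (hle hy)) (Ideal.mul_mem_mul hy (hle hx))
  rw [Group.isSolvable_def]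
  refine ⟨m + 1, ?_⟩
  rw [eq_bot_iff]
  intro u hu
  have h1 := (hU _ _).mp (hD m hu)
  have h2 := Ideal.pow_le_pow_right (I := J) (show m ≤ m + 1 by omega) h1
  rw [hm, Ideal.mem_bot, sub_eq_zero] at h2
  exact Subgroup.mem_bot.mpr (Units.ext h2)

lemma solvable_or_matrix {K A : Type*} [Field K] [IsAlgClosed K] [Ring A] [Algebra K A]
    [FiniteDimensional K A] : Group.IsSolvable Aˣ ∨ ∃ d : ℕ, 2 ≤ d ∧
      ∃ π : A →ₐ[K] Matrix (Fin d) (Fin d) K, Function.Surjective π := by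
  have hart : IsArtinianRing A := IsArtinianRing.of_finite K A
  let J := Ring.jacobson A
  have hss : IsSemisimpleRing (A ⧸ J) := IsSemiprimaryRing.isSemisimpleRing
  obtain ⟨m, hm⟩ := IsSemiprimaryRing.isNilpotent (R := A)
  have hfd : FiniteDimensional K (A ⧸ J) :=
    Module.Finite.of_surjective (Ideal.Quotient.mkₐ K J).toLinearMap (Ideal.Quotient.mkₐ_surjective K J)
  obtain ⟨n, d, hd, ⟨e⟩⟩ := IsSemisimpleRing.exists_algEquiv_pi_matrix_of_isAlgClosed K (A ⧸ J)
  by_cases h : ∃ i, 2 ≤ d i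
  · right
    obtain ⟨i, hi⟩ := h
    refine ⟨d i, hi, (Pi.evalAlgHom K _ i).comp (e.toAlgHom.comp (Ideal.Quotient.mkₐ K J)), ?_⟩
    exact (Function.surjective_eval i).comp
      (e.surjective.comp (Ideal.Quotient.mkₐ_surjective K J))
  · left
    push Not at h
    refine units_solvable_of_nilpotent J m hm ?_
    intro x y
    rw [← Ideal.Quotient.eq_zero_iff_mem, map_sub, sub_eq_zero]
    apply e.injective
    funext i
    have hi := h i
    simp only [map_mul, Pi.mul_apply]
    ext a b
    have hs : Subsingleton (Fin (d i)) := Fin.subsingleton_iff_le_one.mpr (by omega)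
    rw [Matrix.mul_apply, Matrix.mul_apply]
    refine Finset.sum_congr rfl fun c _ => ?_
    rw [Subsingleton.elim a c, Subsingleton.elim b c, mul_comm]

/-- The filter of generic elements of a connected subgroup. -/
def genericFilter {Γ K : Type*} [Group Γ] [Field K] (R : Subalgebra K (Γ → K)) (N : Subgroup Γ)
    (hconn : ∀ f ∈ R, ∀ f' ∈ R, (∀ v ∈ N, f v * f' v = 0) →
      (∀ v ∈ N, f v = 0) ∨ (∀ v ∈ N, f' v = 0)) : Filter N where
  sets := {S | ∃ f ∈ R, (∃ v ∈ N, f v ≠ 0) ∧ ∀ v : N, f v ≠ 0 → v ∈ S}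
  univ_sets := ⟨1, R.one_mem, ⟨1, N.one_mem, by simp⟩, fun _ _ => trivial⟩
  sets_of_superset := by
    rintro S S' ⟨f, hf, hv, hS⟩ hSS
    exact ⟨f, hf, hv, fun v hv => hSS (hS v hv)⟩
  inter_sets := by
    rintro S S' ⟨f, hf, ⟨v, hvN, hv⟩, hS⟩ ⟨f', hf', ⟨v', hvN', hv'⟩, hS'⟩
    refine ⟨f * f', R.mul_mem hf hf', ?_, ?_⟩
    · by_contra! h
      rcases hconn f hf f' hf' h with h | h
      · exact hv (h v hvN)
      · exact hv' (h v' hvN')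
    · intro u hu
      rw [Pi.mul_apply] at hu
      exact ⟨hS u (left_ne_zero_of_mul hu), hS' u (right_ne_zero_of_mul hu)⟩

lemma coordAlg_linear {Γ K : Type*} [Group Γ] [Field K] {k : ℕ}
    (σ : Γ →* Matrix (Fin k) (Fin k) K) (Ψ : Matrix (Fin k) (Fin k) K →ₗ[K] K) :
    (fun g => Ψ (σ g)) ∈ coordAlg (fun _ : Unit => σ) := by
  have : (fun g => Ψ (σ g)) = fun g => ∑ i, ∑ j, σ g i j * Ψ (Matrix.single i j 1) := by
    funext g
    conv_lhs => rw [Matrix.matrix_eq_sum_single (σ g)]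
    simp only [map_sum]
    refine Finset.sum_congr rfl fun i _ => Finset.sum_congr rfl fun j _ => ?_
    have : Matrix.single i j (σ g i j) = σ g i j • Matrix.single i j (1 : K) := by
      rw [Matrix.smul_single, smul_eq_mul, mul_one]
    rw [this, map_smul, smul_eq_mul]
  rw [this]
  refine coordAlg_sum _ _ fun i => coordAlg_sum _ _ fun j => ?_
  exact (coordAlg _).mul_mem (coordAlg_entry (fun _ : Unit => σ) () i j) (coordAlg_const _ _)

theorem solvable_of_connected {Γ K : Type*} [Group Γ] [Field K] [IsAlgClosed K] {k : ℕ}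
    (σ : Γ →* Matrix (Fin k) (Fin k) K) (hσ : Function.Injective σ)
    (N : Subgroup Γ) [N.Normal] [N.FiniteIndex]
    (hconn : ∀ f ∈ coordAlg (fun _ : Unit => σ), ∀ f' ∈ coordAlg (fun _ : Unit => σ),
      (∀ v ∈ N, f v * f' v = 0) → (∀ v ∈ N, f v = 0) ∨ (∀ v ∈ N, f' v = 0))
    {n : ℕ} (w : FreeGroup (Fin n)) (hw : w ≠ 1) (y : Fin n → Γ)
    (hy : ∀ u : Fin n → Γ, (∀ i, u i ∈ N) → FreeGroup.lift (y * u) w = 1) :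
    Group.IsSolvable N := by
  classical
  let A : Subalgebra K (Matrix (Fin k) (Fin k) K) := Algebra.adjoin K (σ '' N)
  have hA : ∀ v : N, σ v ∈ A := fun v => Algebra.subset_adjoin ⟨v, v.2, rfl⟩
  let τ : N →* A :=
    { toFun := fun v => ⟨σ v, hA v⟩
      map_one' := by ext1; simp
      map_mul' := by intro a b; ext1; simp }
  have hτ : ∀ v, (τ v : Matrix (Fin k) (Fin k) K) = σ v := fun _ => rfl
  rcases solvable_or_matrix (K := K) (A := A) with hsol | ⟨d, hd, π, hπ⟩
  · refine Group.isSolvable_of_isSolvable_injective (f := τ.toHomUnits) ?_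
    intro a b hab
    have h1 := congrArg (fun u : Aˣ => ((u : A) : Matrix (Fin k) (Fin k) K)) hab
    exact Subtype.ext (hσ h1)
  exfalso
  let ρ : N →* Matrix (Fin d) (Fin d) K := π.toMonoidHom.comp τ
  have hρ : ∀ v, ρ v = π (τ v) := fun _ => rfl
  -- functionals
  have hfun : ∀ φ : Matrix (Fin d) (Fin d) K →ₗ[K] K,
      ∃ Ψ : Matrix (Fin k) (Fin k) K →ₗ[K] K, ∀ v : N, φ (ρ v) = Ψ (σ v) := by
    intro φ
    obtain ⟨Ψ, hΨ⟩ := LinearMap.exists_extend (p := Subalgebra.toSubmodule A) (φ ∘ₗ π.toLinearMap)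
    refine ⟨Ψ, fun v => ?_⟩
    exact (LinearMap.congr_fun hΨ (τ v)).symm
  have hspan : ∀ φ : Matrix (Fin d) (Fin d) K →ₗ[K] K, (∀ v, φ (ρ v) = 0) → φ = 0 := by
    intro φ hφ
    have h1 : ∀ x (hx : x ∈ A), φ (π ⟨x, hx⟩) = 0 := by
      intro x hx
      obtain ⟨Ψ, hΨ⟩ := LinearMap.exists_extend (p := Subalgebra.toSubmodule A) (φ ∘ₗ π.toLinearMap)
      have h2 : φ (π ⟨x, hx⟩) = Ψ x := (LinearMap.congr_fun hΨ ⟨x, hx⟩).symm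
      rw [h2]
      have h3 : x ∈ Submodule.span K (Submonoid.closure (σ '' N) : Set (Matrix (Fin k) (Fin k) K)) := by
        rw [← Algebra.adjoin_eq_span]; exact hx
      have h4 : Submonoid.closure (σ '' N) = N.toSubmonoid.map σ := by
        have : σ '' N = (N.toSubmonoid.map σ : Set _) := rfl
        rw [this, Submonoid.closure_eq]
      rw [h4] at h3
      have h5 : Submodule.span K (N.toSubmonoid.map σ : Set (Matrix (Fin k) (Fin k) K)) ≤
          LinearMap.ker Ψ := by
        rw [Submodule.span_le]
        rintro _ ⟨v, hv, rfl⟩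
        have h6 : φ (ρ ⟨v, hv⟩) = Ψ (σ v) := (LinearMap.congr_fun hΨ (τ ⟨v, hv⟩)).symm
        rw [hφ] at h6
        exact h6.symm
      exact h5 h3
    ext1 x
    obtain ⟨a, rfl⟩ := hπ x
    exact h1 a.1 a.2
  let G := genericFilter (coordAlg (fun _ : Unit => σ)) N hconn
  have hG : ∀ f ∈ coordAlg (fun _ : Unit => σ), (∃ v : N, f v ≠ 0) → ∀ᶠ v : N in G, f v ≠ 0 := by
    rintro f hf ⟨v, hv⟩
    exact ⟨f, hf, ⟨v, v.2, hv⟩, fun v hv => hv⟩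
  have hne : G.NeBot := by
    constructor
    intro hbot
    have h1 : (∅ : Set N) ∈ G := by rw [hbot]; exact Filter.mem_bot
    obtain ⟨f, hf, ⟨v, hvN, hv⟩, h2⟩ := h1
    exact h2 ⟨v, hvN⟩ hv
  have hUG : ((Ultrafilter.of G : Ultrafilter N) : Filter N) ≤ G := Ultrafilter.of_le G
  let i0 : Fin d := ⟨0, by omega⟩
  let i1 : Fin d := ⟨1, by omega⟩
  have hi : i0 ≠ i1 := by simp [i0, i1]
  let E : Fin d → Fin d → (Matrix (Fin d) (Fin d) K →ₗ[K] K) := fun a b =>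
    Matrix.entryLinearMap K K a b
  have hE : ∀ a b X, E a b X = X a b := fun _ _ _ => rfl
  have hE01 : E i0 i1 ≠ 0 := by
    intro h
    have := LinearMap.congr_fun h (Matrix.single i0 i1 1)
    simp [hE] at this
  obtain ⟨v0, hv0⟩ : ∃ v, ρ v i0 i1 ≠ 0 := by
    by_contra! h
    exact hE01 (hspan _ h)
  obtain ⟨c, e, hce⟩ : ∃ c e, ρ v0⁻¹ c e ≠ 0 := by
    by_contra! h
    have h0 : ρ v0⁻¹ = 0 := by ext c e; exact h c e
    have h1 : ρ v0⁻¹ * ρ v0 = 1 := by rw [← map_mul, inv_mul_cancel, map_one]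
    rw [h0, zero_mul] at h1
    have := congrFun (congrFun h1 i0) i0
    rw [Matrix.zero_apply, Matrix.one_apply_eq] at this
    exact zero_ne_one this
  refine contra_of_ultrafilter ρ (Ultrafilter.of G) ?_ i0 i1 c e ?_ w hw y hy
  · intro W s hW
    refine Filter.Eventually.filter_mono hUG ?_
    obtain ⟨φ, hφ, hφW⟩ := Submodule.exists_le_ker_of_lt_top W (lt_top_iff_ne_top.mpr hW)
    obtain ⟨Ψ, hΨ⟩ := hfun φ
    obtain ⟨v1, hv1⟩ : ∃ v, φ (ρ v) ≠ 0 := by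
      by_contra! h
      exact hφ (hspan _ h)
    have hm1 : (fun g => Ψ (σ (s * g * s⁻¹))) ∈ coordAlg (fun _ : Unit => σ) :=
      coordAlg_left (fun _ : Unit => σ) s _ (coordAlg_right (fun _ : Unit => σ) s⁻¹ _
        (coordAlg_linear σ Ψ))
    have hm2 : (fun g => Ψ (σ (s * g⁻¹ * s⁻¹))) ∈ coordAlg (fun _ : Unit => σ) :=
      coordAlg_inv (fun _ : Unit => σ) _ hm1
    have hc : ∀ v : N, φ (ρ (MulAut.conjNormal s v)) = Ψ (σ (s * v * s⁻¹)) := by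
      intro v
      rw [hΨ, MulAut.conjNormal_apply]
    have hc' : ∀ v : N, φ (ρ (MulAut.conjNormal s v⁻¹)) = Ψ (σ (s * (v : Γ)⁻¹ * s⁻¹)) := by
      intro v
      rw [hΨ, MulAut.conjNormal_apply, Subgroup.coe_inv]
    obtain ⟨v2, rfl⟩ := (MulAut.conjNormal s : MulAut N).surjective v1
    have e1 := hG _ hm1 ⟨v2, by rw [← hc]; exact hv1⟩
    have e2 := hG _ hm2 ⟨v2⁻¹, by rw [← hc', inv_inv]; exact hv1⟩
    filter_upwards [e1, e2] with v hv hv'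
    rw [← hc] at hv
    rw [← hc'] at hv'
    exact ⟨fun h => hv (hφW h), fun h => hv' (hφW h)⟩
  · intro t
    refine Filter.Eventually.filter_mono hUG ?_
    obtain ⟨Ψ, hΨ⟩ := hfun (E i0 i1)
    obtain ⟨Ψ', hΨ'⟩ := hfun (E c e)
    have hm : (fun g => Ψ (σ g) * Ψ' (σ g⁻¹) - t) ∈ coordAlg (fun _ : Unit => σ) := by
      have m1 := coordAlg_linear σ Ψ
      have m2 : (fun g => Ψ' (σ g⁻¹)) ∈ coordAlg (fun _ : Unit => σ) :=
        coordAlg_inv (fun _ : Unit => σ) _ (coordAlg_linear σ Ψ')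
      have m3 := coordAlg_const (fun _ : Unit => σ) t
      exact (coordAlg (fun _ : Unit => σ)).sub_mem
        ((coordAlg (fun _ : Unit => σ)).mul_mem m1 m2) m3
    have hval : ∀ v : N, ρ v i0 i1 * ρ v⁻¹ c e = Ψ (σ v) * Ψ' (σ (v : Γ)⁻¹) := by
      intro v
      have e1 : ρ v i0 i1 = Ψ (σ v) := (hE i0 i1 (ρ v)).symm.trans (hΨ v)
      have e2 : ρ v⁻¹ c e = Ψ' (σ (v : Γ)⁻¹) := (hE c e (ρ v⁻¹)).symm.trans (hΨ' v⁻¹)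
      rw [e1, e2]
    have hex : ∃ v : N, Ψ (σ v) * Ψ' (σ (v : Γ)⁻¹) - t ≠ 0 := by
      by_cases ht : t = 0
      · refine ⟨v0, ?_⟩
        rw [← hval, ht, sub_zero]
        exact mul_ne_zero hv0 hce
      · refine ⟨1, ?_⟩
        rw [← hval, map_one, Matrix.one_apply_ne hi, zero_mul, zero_sub]
        exact neg_ne_zero.mpr ht
    filter_upwards [hG _ hm hex] with v hv
    rw [hval]
    exact sub_ne_zero.mp hv

/-- A finitely generated linear group which satisfies a probabilistic identity satisfies
an identity. -/
theorem satisfies_identity_of_probabilistic_identity (Γ : Type u) [Group Γ] [Group.FG Γ]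
    (hlin : IsLinearGroup.{u, v} Γ)
    (hprob : ∃ (n : ℕ) (w : FreeGroup (Fin n)), IsProbabilisticIdentity Γ w) :
    ∃ (n : ℕ) (w : FreeGroup (Fin n)), w ≠ 1 ∧
      ∀ g : Fin n → Γ, FreeGroup.lift g w = 1 := by
  obtain ⟨F, _, k, ρ, hρ⟩ := hlin
  obtain ⟨n, w, hw⟩ := hprob
  obtain ⟨N₀, hN₀, hN₀f, y, hy⟩ := exists_coset_identity k ρ hρ w hw
  let K := AlgebraicClosure F
  let σ : Γ →* Matrix (Fin k) (Fin k) K :=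
    (algebraMap F K).mapMatrix.toMonoidHom.comp ((Units.coeHom _).comp ρ)
  have hσ : Function.Injective σ := by
    intro a b hab
    apply hρ
    apply Units.ext
    ext i j
    have h1 : algebraMap F K ((ρ a : Matrix (Fin k) (Fin k) F) i j) =
      algebraMap F K ((ρ b : Matrix (Fin k) (Fin k) F) i j) := congrFun (congrFun hab i) j
    exact (algebraMap F K).injective h1
  let τ : Unit → Γ →* Matrix (Fin k) (Fin k) K := fun _ => σ
  obtain ⟨S, hSf, hS⟩ := exists_connected_subgroup (coordEv τ) (coordEv_smul τ)
    (fun f hf => Subtype.ext (funext hf))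
  let N : Subgroup Γ := (N₀ ⊓ S).normalCore
  have hNle : N ≤ N₀ ⊓ S := Subgroup.normalCore_le _
  have hNf : N.FiniteIndex := inferInstance
  have hNn : N.Normal := inferInstance
  have hsol : Group.IsSolvable N := by
    refine solvable_of_connected σ hσ N ?_ w hw.1 y
      (fun u hu => hy u fun i => (hNle (hu i)).1)
    intro f hf f' hf' h
    exact hS N hNf (hNle.trans inf_le_right) ⟨f, hf⟩ ⟨f', hf'⟩ h
  exact identity_of_virtually_solvable N
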